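/- arXiv:2403.09408 — 3 statements merged into one kernel-verified Lean document; each statement's English description precedes it below -/
import Mathlib

section
/- Let a_n denote the number of permutations of {1,...,n} that avoid the pattern 132 and have a unique longest increasing subsequence, and let C_n = binom(2n,n)/(n+1) denote the n-th Catalan number. Then the sequence p_n = a_n / C_n is strictly decreasing for n ≥ 3, i.e., a_n / C_n > a_{n+1} / C_{n+1} for all n ≥ 3. -/
/-- A permutation of `{1,...,n}` avoids the pattern 132 if there are no indices
`i < j < k` with `π i < π k < π j`. -/
def Avoids132 {n : ℕ} (π : Equiv.Perm (Fin n)) : Prop :=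
  ¬ ∃ i j k : Fin n, i < j ∧ j < k ∧ π i < π k ∧ π k < π j

/-- A finite set of indices is an increasing subsequence of `π` if `π` is
strictly monotone on it. -/
def IsIncreasingSubseq {n : ℕ} (π : Equiv.Perm (Fin n)) (s : Finset (Fin n)) : Prop :=
  StrictMonoOn π ↑s

/-- `π` has a unique longest increasing subsequence: there is exactly one
increasing subsequence of maximal length. -/
def HasUniqueLIS {n : ℕ} (π : Equiv.Perm (Fin n)) : Prop :=
  ∃! s : Finset (Fin n), IsIncreasingSubseq π s ∧
    ∀ t : Finset (Fin n), IsIncreasingSubseq π t → t.card ≤ s.card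

/-- The number of 132-avoiding permutations of length `n` with a unique longest
increasing subsequence. -/
noncomputable def numA (n : ℕ) : ℕ :=
  Nat.card {π : Equiv.Perm (Fin n) // Avoids132 π ∧ HasUniqueLIS π}

namespace LISProof

open Finset Equiv

/-- `π` is the composite of `σ` (upper left), a maximum, and `τ` (lower right). -/
structure IsComb {n i j : ℕ} (h : i + j = n) (σ : Perm (Fin i)) (τ : Perm (Fin j))
    (π : Perm (Fin (n + 1))) : Prop where
  left : ∀ (p : Fin (n + 1)) (hp : p.val < i), (π p).val = j + (σ ⟨p.val, hp⟩).val
  mid : ∀ p : Fin (n + 1), p.val = i → (π p).val = n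
  right : ∀ (p : Fin (n + 1)) (hp : i < p.val),
    (π p).val = (τ ⟨p.val - i - 1, by have := p.isLt; omega⟩).val

def combFun {n i j : ℕ} (h : i + j = n) (σ : Perm (Fin i)) (τ : Perm (Fin j))
    (p : Fin (n + 1)) : Fin (n + 1) :=
  if hp : p.val < i then ⟨j + (σ ⟨p.val, hp⟩).val, by have := (σ ⟨p.val, hp⟩).isLt; omega⟩
  else if hq : p.val = i then ⟨n, by omega⟩
  else ⟨(τ ⟨p.val - i - 1, by have := p.isLt; omega⟩).val, by
    have := (τ ⟨p.val - i - 1, by have := p.isLt; omega⟩).isLt; omega⟩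

theorem combFun_inj {n i j : ℕ} (h : i + j = n) (σ : Perm (Fin i)) (τ : Perm (Fin j)) :
    Function.Injective (combFun h σ τ) := by
  intro p q hpq
  have hv := congrArg Fin.val hpq
  unfold combFun at hv
  have e1 : ∀ a : Fin i, (σ a).val < i := fun a => (σ a).isLt
  have e2 : ∀ a : Fin j, (τ a).val < j := fun a => (τ a).isLt
  apply Fin.ext
  split_ifs at hv with h1 h2 h3 h4 h5 h6
  · have : σ ⟨p.val, h1⟩ = σ ⟨q.val, h2⟩ := Fin.ext (by simpa using hv)
    have := σ.injective this
    simpa using this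
  · have := e1 ⟨p.val, h1⟩; simp at hv; omega
  · have := e2 ⟨q.val - i - 1, by have := q.isLt; omega⟩; simp at hv; omega
  · have := e1 ⟨q.val, h5⟩; simp at hv; omega
  · omega
  · have := e2 ⟨q.val - i - 1, by have := q.isLt; omega⟩; simp at hv; omega
  · have := e2 ⟨p.val - i - 1, by have := p.isLt; omega⟩; simp at hv; omega
  · have := e2 ⟨p.val - i - 1, by have := p.isLt; omega⟩; simp at hv; omega
  · have : τ ⟨p.val - i - 1, by have := p.isLt; omega⟩ = τ ⟨q.val - i - 1, by have := q.isLt; omega⟩ :=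
      Fin.ext (by simpa using hv)
    have := τ.injective this
    simp at this
    omega

noncomputable def comb {n i j : ℕ} (h : i + j = n) (σ : Perm (Fin i)) (τ : Perm (Fin j)) :
    Perm (Fin (n + 1)) :=
  Equiv.ofBijective (combFun h σ τ) (Finite.injective_iff_bijective.mp (combFun_inj h σ τ))

theorem comb_isComb {n i j : ℕ} (h : i + j = n) (σ : Perm (Fin i)) (τ : Perm (Fin j)) :
    IsComb h σ τ (comb h σ τ) where
  left p hp := by simp [comb, combFun, hp]
  mid p hp := by simp [comb, combFun, hp]
  right p hp := by
    have h1 : ¬ p.val < i := by omega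
    have h2 : ¬ p.val = i := by omega
    simp [comb, combFun, h1, h2]

theorem IsComb.avoids {n i j : ℕ} {h : i + j = n} {σ : Perm (Fin i)} {τ : Perm (Fin j)}
    {π : Perm (Fin (n + 1))} (H : IsComb h σ τ π) (hσ : Avoids132 σ) (hτ : Avoids132 τ) :
    Avoids132 π := by
  rintro ⟨a, b, c, hab, hbc, h1, h2⟩
  simp only [Fin.lt_def] at hab hbc h1 h2
  have e1 : ∀ a : Fin i, (σ a).val < i := fun a => (σ a).isLt
  have e2 : ∀ a : Fin j, (τ a).val < j := fun a => (τ a).isLt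
  rcases lt_trichotomy a.val i with ha | ha | ha
  · rcases lt_trichotomy c.val i with hc | hc | hc
    · apply hσ
      refine ⟨⟨a, ha⟩, ⟨b, by omega⟩, ⟨c, hc⟩, hab, hbc, ?_, ?_⟩
      · rw [H.left a ha, H.left c hc] at h1
        simp only [Fin.lt_def]; omega
      · rw [H.left b (by omega), H.left c hc] at h2
        simp only [Fin.lt_def]; omega
    · rw [H.mid c hc] at h2
      have := (π b).isLt
      omega
    · rw [H.left a ha, H.right c hc] at h1
      have := e2 ⟨c.val - i - 1, by have := c.isLt; omega⟩
      omega
  · rw [H.mid a ha] at h1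
    have := (π c).isLt
    omega
  · apply hτ
    refine ⟨⟨a - i - 1, by have := a.isLt; omega⟩, ⟨b - i - 1, by have := b.isLt; omega⟩,
      ⟨c - i - 1, by have := c.isLt; omega⟩, ?_, ?_, ?_, ?_⟩
    · simp only [Fin.lt_def]; omega
    · simp only [Fin.lt_def]; omega
    · rw [H.right a ha, H.right c (by omega)] at h1
      exact h1
    · rw [H.right b (by omega), H.right c (by omega)] at h2
      exact h2

theorem exists_comb {n : ℕ} (π : Perm (Fin (n + 1))) (hπ : Avoids132 π) :
    ∃ (i j : ℕ) (h : i + j = n) (σ : Perm (Fin i)) (τ : Perm (Fin j)),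
      Avoids132 σ ∧ Avoids132 τ ∧ IsComb h σ τ π := by
  obtain ⟨m, hm⟩ := π.surjective (Fin.last n)
  have hmn := m.isLt
  have hmax : ∀ p, (π p).val ≤ n := fun p => by have := (π p).isLt; omega
  have hmv : (π m).val = n := by rw [hm]; rfl
  have hneq : ∀ p q, p ≠ q → (π p).val ≠ (π q).val := fun p q hpq hv =>
    hpq (π.injective (Fin.ext hv))
  have hlr : ∀ p q : Fin (n + 1), p < m → m < q → (π q).val < (π p).val := by
    intro p q hp hq
    by_contra hcon
    have h1 := hneq p q (ne_of_lt (hp.trans hq))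
    have h2 := hneq q m (ne_of_gt hq)
    have h3 := hmax q
    exact hπ ⟨p, m, q, hp, hq, by simp only [Fin.lt_def]; omega, by simp only [Fin.lt_def]; omega⟩
  -- lower bound on the left
  have hleft : ∀ p : Fin (n + 1), p < m → n - m.val ≤ (π p).val := by
    intro p hp
    have hc : ((Finset.Ioi m).map π.toEmbedding).card ≤ (Finset.Iio (π p)).card := by
      apply Finset.card_le_card
      intro x hx
      simp only [Finset.mem_map, Finset.mem_Ioi, Equiv.coe_toEmbedding] at hx
      obtain ⟨q, hq, rfl⟩ := hx
      simp only [Finset.mem_Iio, Fin.lt_def]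
      exact hlr p q hp hq
    simp at hc
    omega
  have hright : ∀ q : Fin (n + 1), m < q → (π q).val < n - m.val := by
    intro q hq
    have hc : ((Finset.Iic m).map π.toEmbedding).card ≤ (Finset.Ioi (π q)).card := by
      apply Finset.card_le_card
      intro x hx
      simp only [Finset.mem_map, Finset.mem_Iic, Equiv.coe_toEmbedding] at hx
      obtain ⟨p, hp, rfl⟩ := hx
      simp only [Finset.mem_Ioi, Fin.lt_def]
      rcases lt_or_eq_of_le hp with hp | hp
      · exact hlr p q hp hq
      · have h2 := hneq q m (ne_of_gt hq)
        have h3 := hmax q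
        rw [hp]; omega
    simp at hc
    have := (π q).isLt
    omega
  have hl2 : ∀ p : Fin (n + 1), p < m → (π p).val < n := by
    intro p hp
    have h2 := hneq p m (ne_of_lt hp)
    have h3 := hmax p
    omega
  have hsum : m.val + (n - m.val) = n := by omega
  let f : Fin m.val → Fin m.val := fun a =>
    ⟨(π ⟨a.val, by omega⟩).val - (n - m.val), by
      have := hl2 ⟨a.val, by omega⟩ (by simp [Fin.lt_def])
      have := hleft ⟨a.val, by omega⟩ (by simp [Fin.lt_def])
      omega⟩
  let g : Fin (n - m.val) → Fin (n - m.val) := fun b =>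
    ⟨(π ⟨m.val + 1 + b.val, by omega⟩).val, hright _ (by simp [Fin.lt_def]; omega)⟩
  have hf : Function.Injective f := by
    intro a b hab
    have h1 := hleft ⟨a.val, by omega⟩ (by simp [Fin.lt_def])
    have h2 := hleft ⟨b.val, by omega⟩ (by simp [Fin.lt_def])
    have hv := congrArg Fin.val hab
    simp only [f] at hv
    by_contra hne
    exact hneq ⟨a.val, by omega⟩ ⟨b.val, by omega⟩ (by simpa [Fin.ext_iff] using hne) (by omega)
  have hg : Function.Injective g := by
    intro a b hab
    have hv := congrArg Fin.val hab
    simp only [g] at hv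
    by_contra hne
    exact hneq ⟨m.val + 1 + a.val, by omega⟩ ⟨m.val + 1 + b.val, by omega⟩
      (by simpa [Fin.ext_iff] using hne) hv
  let σ := Equiv.ofBijective f (Finite.injective_iff_bijective.mp hf)
  let τ := Equiv.ofBijective g (Finite.injective_iff_bijective.mp hg)
  refine ⟨m.val, n - m.val, hsum, σ, τ, ?_, ?_, ?_, ?_, ?_⟩
  · rintro ⟨a, b, c, hab, hbc, h1, h2⟩
    simp only [σ, f, Equiv.ofBijective_apply, Fin.lt_def] at h1 h2
    exact hπ ⟨⟨a.val, by omega⟩, ⟨b.val, by omega⟩, ⟨c.val, by omega⟩, hab, hbc, by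
      simp only [Fin.lt_def]; omega, by simp only [Fin.lt_def]; omega⟩
  · rintro ⟨a, b, c, hab, hbc, h1, h2⟩
    simp only [τ, g, Equiv.ofBijective_apply, Fin.lt_def] at h1 h2 hab hbc
    exact hπ ⟨⟨m.val + 1 + a.val, by omega⟩, ⟨m.val + 1 + b.val, by omega⟩,
      ⟨m.val + 1 + c.val, by omega⟩, by simp only [Fin.lt_def]; omega,
      by simp only [Fin.lt_def]; omega, by simp only [Fin.lt_def]; omega,
      by simp only [Fin.lt_def]; omega⟩
  · intro p hp
    have := hleft p hp
    simp only [σ, f, Equiv.ofBijective_apply, Fin.eta]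
    omega
  · intro p hp
    have : p = m := Fin.ext hp
    rw [this, hmv]
  · intro p hp
    have e : (⟨m.val + 1 + (p.val - m.val - 1), by have := p.isLt; omega⟩ : Fin (n + 1)) = p := by
      apply Fin.ext; simp only; omega
    simp only [τ, g, Equiv.ofBijective_apply]
    rw [e]

theorem IsComb.unique {n i j : ℕ} {h : i + j = n} {σ σ' : Perm (Fin i)} {τ τ' : Perm (Fin j)}
    {π : Perm (Fin (n + 1))} (H : IsComb h σ τ π) (H' : IsComb h σ' τ' π) : σ = σ' ∧ τ = τ' := by
  constructor
  · ext a
    have h1 := H.left ⟨a.val, by omega⟩ a.isLt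
    have h2 := H'.left ⟨a.val, by omega⟩ a.isLt
    simp only [Fin.eta] at h1 h2
    omega
  · ext a
    have h1 := H.right ⟨i + 1 + a.val, by omega⟩ (by simp only; omega)
    have h2 := H'.right ⟨i + 1 + a.val, by omega⟩ (by simp only; omega)
    have e : ∀ hh, (⟨i + 1 + a.val - i - 1, hh⟩ : Fin j) = a := by
      intro hh; apply Fin.ext; simp only; omega
    simp only [e] at h1 h2
    omega

theorem IsComb.eq {n i j : ℕ} {h : i + j = n} {σ : Perm (Fin i)} {τ : Perm (Fin j)}
    {π π' : Perm (Fin (n + 1))} (H : IsComb h σ τ π) (H' : IsComb h σ τ π') : π = π' := by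
  ext p
  rcases lt_trichotomy p.val i with hp | hp | hp
  · rw [H.left p hp, H'.left p hp]
  · rw [H.mid p hp, H'.mid p hp]
  · rw [H.right p hp, H'.right p hp]

theorem IsComb.index {n i j i' j' : ℕ} {h : i + j = n} {h' : i' + j' = n}
    {σ : Perm (Fin i)} {τ : Perm (Fin j)} {σ' : Perm (Fin i')} {τ' : Perm (Fin j')}
    {π : Perm (Fin (n + 1))} (H : IsComb h σ τ π) (H' : IsComb h' σ' τ' π) : i = i' := by
  have h1 := H.mid ⟨i, by omega⟩ rfl
  have h2 := H'.mid ⟨i', by omega⟩ rfl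
  have := π.injective (Fin.ext (h1.trans h2.symm))
  simpa using this

abbrev Av (n : ℕ) := {π : Perm (Fin n) // Avoids132 π}

noncomputable instance (n : ℕ) : Fintype (Av n) := Fintype.ofFinite _

theorem sum_Av_succ (n : ℕ) (f : Av (n + 1) → ℕ) (g : ∀ i j : ℕ, Av i → Av j → ℕ)
    (hfg : ∀ i j (h : i + j = n) (σ : Av i) (τ : Av j) (π : Av (n + 1)),
      IsComb h σ.1 τ.1 π.1 → f π = g i j σ τ) :
    ∑ π, f π = ∑ p ∈ Finset.HasAntidiagonal.antidiagonal n, ∑ σ : Av p.1, ∑ τ : Av p.2, g p.1 p.2 σ τ := by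
  classical
  let T := Σ p : {p : ℕ × ℕ // p ∈ Finset.HasAntidiagonal.antidiagonal n}, Av p.1.1 × Av p.1.2
  have hT : ∀ p : {p : ℕ × ℕ // p ∈ Finset.HasAntidiagonal.antidiagonal n}, p.1.1 + p.1.2 = n := fun p =>
    Finset.HasAntidiagonal.mem_antidiagonal.mp p.2
  let F : T → Av (n + 1) := fun t => ⟨comb (hT t.1) t.2.1.1 t.2.2.1,
    (comb_isComb (hT t.1) t.2.1.1 t.2.2.1).avoids t.2.1.2 t.2.2.2⟩
  have hF : ∀ t, IsComb (hT t.1) t.2.1.1 t.2.2.1 (F t).1 := fun t => comb_isComb _ _ _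
  have hbij : Function.Bijective F := by
    constructor
    · rintro ⟨⟨⟨i, j⟩, hp⟩, σ, τ⟩ ⟨⟨⟨i', j'⟩, hp'⟩, σ', τ'⟩ hst
      have H := hF ⟨⟨⟨i, j⟩, hp⟩, σ, τ⟩
      have H' := hF ⟨⟨⟨i', j'⟩, hp'⟩, σ', τ'⟩
      rw [← hst] at H'
      have e := H.index H'
      simp only at e
      have e2 : j = j' := by
        simp only [Finset.HasAntidiagonal.mem_antidiagonal] at hp hp'; omega
      subst e; subst e2
      obtain ⟨h1, h2⟩ := H.unique H'
      have h1' : σ = σ' := Subtype.ext h1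
      have h2' : τ = τ' := Subtype.ext h2
      rw [h1', h2']
    · rintro ⟨π, hπ⟩
      obtain ⟨i, j, h, σ, τ, h1, h2, H⟩ := exists_comb π hπ
      refine ⟨⟨⟨⟨i, j⟩, Finset.HasAntidiagonal.mem_antidiagonal.mpr h⟩, ⟨σ, h1⟩, ⟨τ, h2⟩⟩, ?_⟩
      apply Subtype.ext
      exact (hF ⟨⟨⟨i, j⟩, Finset.HasAntidiagonal.mem_antidiagonal.mpr h⟩, ⟨σ, h1⟩, ⟨τ, h2⟩⟩).eq H
  rw [← (Equiv.ofBijective F hbij).sum_comp]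
  rw [Fintype.sum_sigma]
  rw [← Finset.sum_coe_sort (Finset.HasAntidiagonal.antidiagonal n)]
  apply Finset.sum_congr rfl
  intro p _
  rw [Fintype.sum_prod_type]
  apply Finset.sum_congr rfl
  intro σ _
  apply Finset.sum_congr rfl
  intro τ _
  exact hfg _ _ (hT p) σ τ _ (hF ⟨p, σ, τ⟩)

end LISProof

namespace LISProof

open Finset Equiv

open Classical in
/-- increasing subsequences of length `k` -/
noncomputable def Inc {n : ℕ} (π : Perm (Fin n)) (k : ℕ) : Finset (Finset (Fin n)) :=
  univ.filter (fun s => IsIncreasingSubseq π s ∧ s.card = k)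

noncomputable def inc {n : ℕ} (π : Perm (Fin n)) (k : ℕ) : ℕ := (Inc π k).card

theorem mem_Inc {n : ℕ} (π : Perm (Fin n)) (k : ℕ) (s : Finset (Fin n)) :
    s ∈ Inc π k ↔ (∀ a ∈ s, ∀ b ∈ s, a < b → π a < π b) ∧ s.card = k := by
  simp only [Inc, mem_filter, mem_univ, true_and, IsIncreasingSubseq, StrictMonoOn, Finset.mem_coe]

theorem inc_zero {n : ℕ} (π : Perm (Fin n)) : inc π 0 = 1 := by
  unfold inc
  rw [Finset.card_eq_one]
  refine ⟨∅, ?_⟩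
  ext s
  rw [mem_Inc]
  simp only [Finset.card_eq_zero, mem_singleton]
  constructor
  · exact fun h => h.2
  · rintro rfl; simp

theorem inc_succ_eq_zero {n : ℕ} (π : Perm (Fin n)) (k : ℕ) (h : inc π k = 0) :
    inc π (k + 1) = 0 := by
  unfold inc at *
  rw [Finset.card_eq_zero] at *
  by_contra hne
  obtain ⟨s, hs⟩ := Finset.nonempty_iff_ne_empty.mpr hne
  rw [mem_Inc] at hs
  obtain ⟨a, ha⟩ : s.Nonempty := by
    rw [← Finset.card_pos]; omega
  have : s.erase a ∈ Inc π k := by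
    rw [mem_Inc]
    refine ⟨fun x hx y hy => hs.1 x (mem_of_mem_erase hx) y (mem_of_mem_erase hy), ?_⟩
    rw [Finset.card_erase_of_mem ha]; omega
  rw [h] at this
  simp at this

theorem inc_eq_zero_of_le {n : ℕ} (π : Perm (Fin n)) (k l : ℕ) (hkl : k ≤ l) (h : inc π k = 0) :
    inc π l = 0 := by
  induction l, hkl using Nat.le_induction with
  | base => exact h
  | succ m _ ih => exact inc_succ_eq_zero π m ih

theorem inc_big {n : ℕ} (π : Perm (Fin n)) : inc π (n + 1) = 0 := by
  unfold inc
  rw [Finset.card_eq_zero]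
  by_contra hne
  obtain ⟨s, hs⟩ := Finset.nonempty_iff_ne_empty.mpr hne
  rw [mem_Inc] at hs
  have := Finset.card_le_univ s
  simp at this
  omega

theorem inc_one {n : ℕ} (π : Perm (Fin (n + 1))) : inc π 1 ≠ 0 := by
  unfold inc
  apply Finset.card_ne_zero_of_mem (a := {0})
  rw [mem_Inc]
  simp

def eR (n i j : ℕ) (h : i + j = n) : Fin j ↪ Fin (n + 1) :=
  ⟨fun b => ⟨i + 1 + b.val, by omega⟩, fun a b hab => by
    simp at hab; exact Fin.ext hab⟩

def eL (n i j : ℕ) (h : i + j = n) : Fin i ↪ Fin (n + 1) :=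
  ⟨fun b => ⟨b.val, by omega⟩, fun a b hab => by
    simp at hab; exact Fin.ext hab⟩

theorem IsComb.inc_eq {n i j : ℕ} {h : i + j = n} {σ : Perm (Fin i)} {τ : Perm (Fin j)}
    {π : Perm (Fin (n + 1))} (H : IsComb h σ τ π) (k : ℕ) :
    inc π (k + 1) = inc σ (k + 1) + inc σ k + inc τ (k + 1) := by
  classical
  have e1 : ∀ a : Fin i, (σ a).val < i := fun a => (σ a).isLt
  have e2 : ∀ a : Fin j, (τ a).val < j := fun a => (τ a).isLt
  have hL : ∀ a : Fin i, (π (eL n i j h a)).val = j + (σ a).val := fun a => H.left _ a.isLt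
  have hR : ∀ b : Fin j, (π (eR n i j h b)).val = (τ b).val := fun b => by
    have := H.right (eR n i j h b) (by show i < i + 1 + b.val; omega)
    rw [this]
    congr 2
    apply Fin.ext
    show i + 1 + b.val - i - 1 = b.val; omega
  let mid : Fin (n + 1) := ⟨i, by omega⟩
  have hM : (π mid).val = n := H.mid mid rfl
  have hLv : ∀ a, (eL n i j h a).val = a.val := fun a => rfl
  have hRv : ∀ a, (eR n i j h a).val = i + 1 + a.val := fun a => rfl
  have hMv : mid.val = i := rfl
  have cases3 : ∀ p : Fin (n + 1), (∃ a, eL n i j h a = p) ∨ p = mid ∨ ∃ b, eR n i j h b = p := by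
    intro p
    rcases lt_trichotomy p.val i with hp | hp | hp
    · exact Or.inl ⟨⟨p, hp⟩, rfl⟩
    · exact Or.inr (Or.inl (Fin.ext hp))
    · refine Or.inr (Or.inr ⟨⟨p - i - 1, by have := p.isLt; omega⟩, Fin.ext ?_⟩)
      rw [hRv]; simp only; omega
  have midL : ∀ s : Finset (Fin i), mid ∉ s.map (eL n i j h) := by
    intro s hs
    obtain ⟨a, _, ha⟩ := Finset.mem_map.mp hs
    have := congrArg Fin.val ha
    rw [hLv, hMv] at this
    have := a.isLt
    omega
  have midR : ∀ s : Finset (Fin j), mid ∉ s.map (eR n i j h) := by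
    intro s hs
    obtain ⟨a, _, ha⟩ := Finset.mem_map.mp hs
    have := congrArg Fin.val ha
    rw [hRv, hMv] at this
    omega
  let A := (Inc σ (k + 1)).image (fun s => s.map (eL n i j h))
  let B := (Inc σ k).image (fun s => insert mid (s.map (eL n i j h)))
  let D := (Inc τ (k + 1)).image (fun s => s.map (eR n i j h))
  have hunion : Inc π (k + 1) = A ∪ B ∪ D := by
    ext s
    simp only [A, B, D, mem_union, mem_image]
    constructor
    · intro hs
      rw [mem_Inc] at hs
      obtain ⟨hs, hc⟩ := hs
      by_cases hm : mid ∈ s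
      · left; right
        have hsub : s.erase mid ⊆ univ.map (eL n i j h) := by
          intro p hp
          rw [mem_erase] at hp
          rcases cases3 p with ⟨a, rfl⟩ | hp' | ⟨b, rfl⟩
          · simp
          · exact absurd hp' hp.1
          · exfalso
            have := hs mid hm _ hp.2 (by rw [Fin.lt_def, hRv, hMv]; omega)
            rw [Fin.lt_def, hM, hR] at this
            have := e2 b
            omega
        obtain ⟨u, _, hu⟩ := Finset.subset_map_iff.mp hsub
        refine ⟨u, ?_, ?_⟩
        · rw [mem_Inc]
          constructor
          · intro a ha b hb hab
            have ha' : eL n i j h a ∈ s := mem_of_mem_erase (hu ▸ Finset.mem_map_of_mem _ ha)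
            have hb' : eL n i j h b ∈ s := mem_of_mem_erase (hu ▸ Finset.mem_map_of_mem _ hb)
            have := hs _ ha' _ hb' hab
            rw [Fin.lt_def, hL, hL] at this
            rw [Fin.lt_def]; omega
          · have := congrArg Finset.card hu
            rw [Finset.card_map, Finset.card_erase_of_mem hm] at this
            omega
        · rw [← hu, Finset.insert_erase hm]
      · by_cases hl : ∃ a, eL n i j h a ∈ s
        · left; left
          obtain ⟨a0, ha0⟩ := hl
          have hsub : s ⊆ univ.map (eL n i j h) := by
            intro p hp
            rcases cases3 p with ⟨a, rfl⟩ | hp' | ⟨b, rfl⟩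
            · simp
            · exact absurd (hp' ▸ hp) hm
            · exfalso
              have := hs _ ha0 _ hp (by rw [Fin.lt_def, hRv, hLv]; omega)
              rw [Fin.lt_def, hL, hR] at this
              have := e2 b
              omega
          obtain ⟨u, _, hu⟩ := Finset.subset_map_iff.mp hsub
          refine ⟨u, ?_, hu.symm⟩
          rw [mem_Inc]
          constructor
          · intro a ha b hb hab
            have ha' : eL n i j h a ∈ s := (hu ▸ Finset.mem_map_of_mem _ ha)
            have hb' : eL n i j h b ∈ s := (hu ▸ Finset.mem_map_of_mem _ hb)
            have := hs _ ha' _ hb' hab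
            rw [Fin.lt_def, hL, hL] at this
            rw [Fin.lt_def]; omega
          · have := congrArg Finset.card hu
            rw [Finset.card_map] at this
            omega
        · right
          have hsub : s ⊆ univ.map (eR n i j h) := by
            intro p hp
            rcases cases3 p with ⟨a, rfl⟩ | hp' | ⟨b, rfl⟩
            · exact absurd ⟨a, hp⟩ hl
            · exact absurd (hp' ▸ hp) hm
            · simp
          obtain ⟨u, _, hu⟩ := Finset.subset_map_iff.mp hsub
          refine ⟨u, ?_, hu.symm⟩
          rw [mem_Inc]
          constructor
          · intro a ha b hb hab
            have ha' : eR n i j h a ∈ s := (hu ▸ Finset.mem_map_of_mem _ ha)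
            have hb' : eR n i j h b ∈ s := (hu ▸ Finset.mem_map_of_mem _ hb)
            have := hs _ ha' _ hb' (by rw [Fin.lt_def, hRv, hRv]; rw [Fin.lt_def] at hab; omega)
            rw [Fin.lt_def, hR, hR] at this
            exact this
          · have := congrArg Finset.card hu
            rw [Finset.card_map] at this
            omega
    · rintro ((⟨u, hu, rfl⟩ | ⟨u, hu, rfl⟩) | ⟨u, hu, rfl⟩)
      · rw [mem_Inc] at *
        refine ⟨?_, by rw [Finset.card_map]; exact hu.2⟩
        intro p hp q hq hpq
        obtain ⟨a, ha, rfl⟩ := Finset.mem_map.mp hp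
        obtain ⟨b, hb, rfl⟩ := Finset.mem_map.mp hq
        have := hu.1 a ha b hb hpq
        rw [Fin.lt_def] at *
        rw [hL, hL]; omega
      · rw [mem_Inc] at *
        refine ⟨?_, by rw [Finset.card_insert_of_notMem (midL u), Finset.card_map, hu.2]⟩
        intro p hp q hq hpq
        rw [Finset.mem_insert] at hp hq
        rcases hp with rfl | hp
        · rcases hq with rfl | hq
          · exact absurd hpq (lt_irrefl _)
          · obtain ⟨b, hb, rfl⟩ := Finset.mem_map.mp hq
            rw [Fin.lt_def, hLv, hMv] at hpq
            omega
        · obtain ⟨a, ha, rfl⟩ := Finset.mem_map.mp hp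
          rcases hq with rfl | hq
          · rw [Fin.lt_def, hL, hM]
            have := e1 a
            omega
          · obtain ⟨b, hb, rfl⟩ := Finset.mem_map.mp hq
            have := hu.1 a ha b hb hpq
            rw [Fin.lt_def] at *
            rw [hL, hL]; omega
      · rw [mem_Inc] at *
        refine ⟨?_, by rw [Finset.card_map]; exact hu.2⟩
        intro p hp q hq hpq
        obtain ⟨a, ha, rfl⟩ := Finset.mem_map.mp hp
        obtain ⟨b, hb, rfl⟩ := Finset.mem_map.mp hq
        have := hu.1 a ha b hb (by
          rw [Fin.lt_def, hRv, hRv] at hpq; rw [Fin.lt_def]; omega)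
        rw [Fin.lt_def] at *
        rw [hR, hR]; omega
  have hAB : Disjoint A B := by
    rw [Finset.disjoint_left]
    simp only [A, B, mem_image]
    rintro s ⟨u, _, rfl⟩ ⟨u', _, hu'⟩
    exact midL u (hu' ▸ Finset.mem_insert_self _ _)
  have hABD : Disjoint (A ∪ B) D := by
    rw [Finset.disjoint_left]
    simp only [A, B, D, mem_image, mem_union]
    rintro s (⟨u, hu, rfl⟩ | ⟨u, _, rfl⟩) ⟨u', _, hu'⟩
    · rw [mem_Inc] at hu
      obtain ⟨a, ha⟩ : u.Nonempty := by rw [← Finset.card_pos]; omega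
      have : eL n i j h a ∈ u'.map (eR n i j h) := hu' ▸ Finset.mem_map_of_mem _ ha
      obtain ⟨b, _, hb⟩ := Finset.mem_map.mp this
      have := congrArg Fin.val hb
      rw [hLv, hRv] at this
      omega
    · exact midR u' (hu' ▸ Finset.mem_insert_self _ _)
  unfold inc
  rw [hunion, Finset.card_union_of_disjoint hABD, Finset.card_union_of_disjoint hAB]
  rw [Finset.card_image_of_injective _ (Finset.map_injective _),
    Finset.card_image_of_injective _ (Finset.map_injective _), Finset.card_image_of_injOn]
  intro u _ u' _ huu
  dsimp only at huu
  have : (insert mid (u.map (eL n i j h))).erase mid = (insert mid (u'.map (eL n i j h))).erase mid :=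
    by rw [huu]
  rw [Finset.erase_insert (midL u), Finset.erase_insert (midL u')] at this
  exact Finset.map_injective _ this

open Classical in
/-- number of avoiders with no increasing subsequence of length `k` -/
noncomputable def zc (n k : ℕ) : ℕ := ∑ π : Av n, if inc π.1 k = 0 then 1 else 0

/-- number of avoiders whose unique longest increasing subsequence has length `k` -/
noncomputable def uq (n k : ℕ) : ℕ :=
  ∑ π : Av n, if inc π.1 k = 1 ∧ inc π.1 (k + 1) = 0 then 1 else 0

theorem zc_zero_right (n : ℕ) : zc n 0 = 0 := by
  unfold zc
  simp [inc_zero]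

theorem card_Av_zero : Fintype.card (Av 0) = 1 := by
  rw [Fintype.card_eq_one_iff]
  refine ⟨⟨1, by rintro ⟨i, _⟩; exact i.elim0⟩, ?_⟩
  rintro ⟨y, hy⟩
  apply Subtype.ext
  exact Subsingleton.elim _ _

theorem zc_zero_left (k : ℕ) : zc 0 (k + 1) = 1 := by
  unfold zc
  have : ∀ π : Av 0, inc π.1 (k + 1) = 0 := fun π =>
    inc_eq_zero_of_le π.1 1 (k + 1) (by omega) (inc_big π.1)
  simp [this, card_Av_zero]

theorem zc_succ (n k : ℕ) :
    zc (n + 1) (k + 1) = ∑ p ∈ HasAntidiagonal.antidiagonal n, zc p.1 k * zc p.2 (k + 1) := by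
  unfold zc
  rw [sum_Av_succ n _ (fun i j σ τ => (if inc σ.1 k = 0 then 1 else 0) *
    (if inc τ.1 (k + 1) = 0 then 1 else 0))]
  · apply Finset.sum_congr rfl
    intro p _
    rw [Finset.sum_mul_sum]
  · intro i j h σ τ π H
    have := H.inc_eq k
    have h1 := inc_succ_eq_zero σ.1 k
    split_ifs <;> omega

theorem uq_zero_zero : uq 0 0 = 1 := by
  unfold uq
  have : ∀ π : Av 0, inc π.1 1 = 0 := fun π => inc_big π.1
  simp [this, inc_zero, card_Av_zero]

theorem uq_zero_succ (k : ℕ) : uq 0 (k + 1) = 0 := by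
  unfold uq
  have : ∀ π : Av 0, inc π.1 (k + 1) = 0 := fun π =>
    inc_eq_zero_of_le π.1 1 (k + 1) (by omega) (inc_big π.1)
  simp [this]

theorem uq_succ_zero (n : ℕ) : uq (n + 1) 0 = 0 := by
  unfold uq
  simp [inc_one]

theorem uq_succ (n k : ℕ) :
    uq (n + 1) (k + 1) = ∑ p ∈ HasAntidiagonal.antidiagonal n,
      (uq p.1 k * zc p.2 (k + 1) + zc p.1 k * uq p.2 (k + 1)) := by
  unfold uq zc
  rw [sum_Av_succ n _ (fun i j σ τ => (if inc σ.1 k = 1 ∧ inc σ.1 (k + 1) = 0 then 1 else 0) *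
    (if inc τ.1 (k + 1) = 0 then 1 else 0) + (if inc σ.1 k = 0 then 1 else 0) *
    (if inc τ.1 (k + 1) = 1 ∧ inc τ.1 (k + 1 + 1) = 0 then 1 else 0))]
  · apply Finset.sum_congr rfl
    intro p _
    rw [Finset.sum_mul_sum, Finset.sum_mul_sum, ← Finset.sum_add_distrib]
    apply Finset.sum_congr rfl
    intro σ _
    rw [← Finset.sum_add_distrib]
  · intro i j h σ τ π H
    have e1 := H.inc_eq k
    have e2 := H.inc_eq (k + 1)
    have h1 := inc_succ_eq_zero σ.1 k
    have h2 := inc_succ_eq_zero σ.1 (k + 1)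
    have h3 := inc_succ_eq_zero τ.1 (k + 1)
    by_cases a1 : inc σ.1 k = 0 <;> by_cases a2 : inc σ.1 (k + 1) = 0 <;>
      by_cases a3 : inc τ.1 (k + 1) = 0 <;> by_cases a4 : inc τ.1 (k + 1 + 1) = 0 <;>
      by_cases a5 : inc σ.1 k = 1 <;> by_cases a6 : inc τ.1 (k + 1) = 1 <;>
      simp_all <;> omega

theorem unique_iff {n : ℕ} (π : Perm (Fin n)) :
    HasUniqueLIS π ↔ ∃ k, inc π k = 1 ∧ inc π (k + 1) = 0 := by
  have mem' : ∀ s k, s ∈ Inc π k ↔ IsIncreasingSubseq π s ∧ s.card = k := by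
    intro s k; simp [Inc]
  constructor
  · rintro ⟨s, ⟨hs, hmax⟩, huniq⟩
    refine ⟨s.card, ?_, ?_⟩
    · unfold inc
      rw [Finset.card_eq_one]
      refine ⟨s, ?_⟩
      ext t
      rw [mem', mem_singleton]
      constructor
      · rintro ⟨ht, hc⟩
        exact huniq t ⟨ht, fun u hu => by rw [hc]; exact hmax u hu⟩
      · rintro rfl; exact ⟨hs, rfl⟩
    · unfold inc
      rw [Finset.card_eq_zero, Finset.eq_empty_iff_forall_notMem]
      intro t ht
      rw [mem'] at ht
      have := hmax t ht.1
      omega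
  · rintro ⟨k, h1, h2⟩
    have hle : ∀ t, IsIncreasingSubseq π t → t.card ≤ k := by
      intro t ht
      by_contra hcon
      have := inc_eq_zero_of_le π (k + 1) t.card (by omega) h2
      unfold inc at this
      rw [Finset.card_eq_zero, Finset.eq_empty_iff_forall_notMem] at this
      exact this t ((mem' _ _).mpr ⟨ht, rfl⟩)
    unfold inc at h1
    rw [Finset.card_eq_one] at h1
    obtain ⟨s, hs⟩ := h1
    have hs' : s ∈ Inc π k := by rw [hs]; simp
    rw [mem'] at hs'
    refine ⟨s, ⟨hs'.1, fun t ht => by rw [hs'.2]; exact hle t ht⟩, ?_⟩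
    rintro t ⟨ht, hmax⟩
    have h3 := hmax s hs'.1
    have h4 := hle t ht
    have : t ∈ Inc π k := (mem' _ _).mpr ⟨ht, by omega⟩
    rw [hs] at this
    simpa using this

theorem numA_eq (n N : ℕ) (hN : n ≤ N) : numA n = ∑ k ∈ range (N + 1), uq n k := by
  classical
  unfold uq
  rw [Finset.sum_comm]
  have key : ∀ π : Av n, (∑ k ∈ range (N + 1), if inc π.1 k = 1 ∧ inc π.1 (k + 1) = 0 then 1 else 0)
      = if HasUniqueLIS π.1 then 1 else 0 := by
    intro π
    split_ifs with h
    · obtain ⟨k, h1, h2⟩ := (unique_iff π.1).mp h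
      have hk : k ≤ n := by
        by_contra hcon
        have := inc_eq_zero_of_le π.1 (n + 1) k (by omega) (inc_big π.1)
        omega
      rw [Finset.sum_eq_single k]
      · simp [h1, h2]
      · intro b _ hb
        rw [if_neg]
        rintro ⟨h3, h4⟩
        rcases lt_or_gt_of_ne hb with hlt | hlt
        · have := inc_eq_zero_of_le π.1 (b + 1) k (by omega) h4; omega
        · have := inc_eq_zero_of_le π.1 (k + 1) b (by omega) h2; omega
      · intro hk'; simp at hk'; omega
    · apply Finset.sum_eq_zero
      intro k _
      rw [if_neg]
      intro hk
      exact h ((unique_iff π.1).mpr ⟨k, hk⟩)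
  rw [Finset.sum_congr rfl (fun π _ => key π)]
  rw [Finset.sum_boole, numA]
  rw [Nat.cast_id, ← Fintype.card_subtype, ← Nat.card_eq_fintype_card]
  exact Nat.card_congr (Equiv.subtypeSubtypeEquivSubtypeInter _ _).symm

end LISProof

namespace LISProof

open Finset PowerSeries

/-- generating function of `zc` -/
noncomputable def Ph (k : ℕ) : ℚ⟦X⟧ := PowerSeries.mk fun n => (zc n k : ℚ)

/-- generating function of `uq` -/
noncomputable def gs (k : ℕ) : ℚ⟦X⟧ := PowerSeries.mk fun n => (uq n k : ℚ)

theorem Ph_zero : Ph 0 = 0 := by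
  ext n; simp [Ph, zc_zero_right]

theorem Ph_succ (k : ℕ) : Ph (k + 1) = 1 + X * (Ph k * Ph (k + 1)) := by
  ext n
  cases n with
  | zero => simp [Ph, zc_zero_left]
  | succ n =>
    rw [map_add, PowerSeries.coeff_succ_X_mul, PowerSeries.coeff_mul, PowerSeries.coeff_one]
    simp [Ph, zc_succ]

theorem gs_zero : gs 0 = 1 := by
  ext n
  cases n with
  | zero => simp [gs, uq_zero_zero]
  | succ n => simp [gs, uq_succ_zero, PowerSeries.coeff_one]

theorem gs_succ (k : ℕ) : gs (k + 1) = X * (gs k * Ph (k + 1) + Ph k * gs (k + 1)) := by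
  ext n
  cases n with
  | zero => simp [gs, uq_zero_succ]
  | succ n =>
    rw [PowerSeries.coeff_succ_X_mul, map_add, PowerSeries.coeff_mul, PowerSeries.coeff_mul,
      ← Finset.sum_add_distrib]
    simp [Ph, gs, uq_succ]

theorem gs_succ' (k : ℕ) : gs (k + 1) = X * Ph (k + 1) ^ 2 * gs k := by
  linear_combination Ph (k + 1) * gs_succ k - gs (k + 1) * Ph_succ k

theorem gs_eq (k : ℕ) : gs k = 1 - Ph k + X * Ph k ^ 2 := by
  induction k with
  | zero => simp [gs_zero, Ph_zero]
  | succ k ih =>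
    rw [gs_succ', ih]
    have h := Ph_succ k
    linear_combination ((-X * Ph (k+1) * Ph k) + (1 - X) * 0 + (1:ℚ⟦X⟧)) * h

/-- coefficientwise nonnegative -/
def NN (f : ℚ⟦X⟧) : Prop := ∀ n, 0 ≤ PowerSeries.coeff n f

theorem NN.add {f g : ℚ⟦X⟧} (hf : NN f) (hg : NN g) : NN (f + g) := fun n => by
  rw [map_add]; exact add_nonneg (hf n) (hg n)

theorem NN.mul {f g : ℚ⟦X⟧} (hf : NN f) (hg : NN g) : NN (f * g) := fun n => by
  rw [PowerSeries.coeff_mul]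
  exact Finset.sum_nonneg fun p _ => mul_nonneg (hf _) (hg _)

theorem NN_C {c : ℚ} (hc : 0 ≤ c) : NN (PowerSeries.C c) := fun n => by
  rw [PowerSeries.coeff_C]; split_ifs <;> simp [hc]

theorem NN_one : NN 1 := fun n => by
  rw [PowerSeries.coeff_one]; split_ifs <;> simp

theorem NN_zero : NN 0 := fun n => by simp

theorem NN_X : NN X := fun n => by
  rw [PowerSeries.coeff_X]; split_ifs <;> simp

theorem NN.pow {f : ℚ⟦X⟧} (hf : NN f) (k : ℕ) : NN (f ^ k) := by
  induction k with
  | zero => simpa using NN_one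
  | succ k ih => rw [pow_succ]; exact ih.mul hf

theorem NN_of_inv {f q : ℚ⟦X⟧} (hq : NN q) (h : f = 1 + X * (q * f)) : NN f := by
  intro n
  induction n using Nat.strong_induction_on with
  | _ n ih =>
    rw [h]
    cases n with
    | zero => simp
    | succ n =>
      rw [map_add, PowerSeries.coeff_succ_X_mul, PowerSeries.coeff_mul]
      refine add_nonneg (NN_one _) (Finset.sum_nonneg fun p hp => mul_nonneg (hq _) (ih _ ?_))
      rw [Finset.HasAntidiagonal.mem_antidiagonal] at hp
      omega

theorem NN_Ph (k : ℕ) : NN (Ph k) := fun n => by simp [Ph]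

theorem NN_gs (k : ℕ) : NN (gs k) := fun n => by simp [gs]

theorem NN_Ph_sub (k : ℕ) : NN (Ph (k + 1) - Ph k) := by
  induction k with
  | zero => rw [Ph_zero, sub_zero]; exact NN_Ph _
  | succ k ih =>
    have : Ph (k + 1 + 1) - Ph (k + 1) = X * Ph (k + 2) * Ph (k + 1) * (Ph (k + 1) - Ph k) := by
      have h1 := Ph_succ k
      have h2 := Ph_succ (k + 1)
      linear_combination Ph (k + 1) * h2 - Ph (k + 2) * h1
    rw [this]
    exact ((NN_X.mul (NN_Ph _)).mul (NN_Ph _)).mul ih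

noncomputable def ys (t : ℕ) : ℚ⟦X⟧ := X * (Ph (t + 2) - Ph t)

noncomputable def els (t : ℕ) : ℚ⟦X⟧ := 1 - 2 * X * Ph t

theorem NN_ys (t : ℕ) : NN (ys t) := by
  have : ys t = X * ((Ph (t + 1 + 1) - Ph (t + 1)) + (Ph (t + 1) - Ph t)) := by
    unfold ys; ring
  rw [this]
  exact NN_X.mul ((NN_Ph_sub _).add (NN_Ph_sub _))

theorem els_sub (t : ℕ) : els t - els (t + 2) = 2 * ys t := by
  unfold els ys; ring

theorem els_mul (t : ℕ) : els t * els (t + 2) = (1 - 4 * X) + 2 * (1 - 2 * X) * ys t := by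
  have h1 := Ph_succ t
  have h2 := Ph_succ (t + 1)
  unfold els ys
  have key : Ph (t + 2) * (1 - X * Ph t - X) = 1 - X * Ph t := by
    linear_combination (1 - X * Ph t) * h2 + X * Ph (t + 2) * h1
  linear_combination (-4 * X) * key

theorem xs_eq (t : ℕ) : ys t = gs (t + 1) + gs (t + 1) * ys t := by
  have h1 := Ph_succ t
  have h2 := Ph_succ (t + 1)
  rw [gs_eq]
  unfold ys
  have key : Ph (t + 2) * (1 - X * Ph t - X) = 1 - X * Ph t := by
    linear_combination (1 - X * Ph t) * h2 + X * Ph (t + 2) * h1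
  have hf : Ph (t + 1) * (1 - X * Ph t) = 1 := by linear_combination h1
  have e1 : Ph (t + 1) * (X * (Ph (t + 2) - Ph t)) = Ph (t + 2) - Ph (t + 1) := by
    linear_combination h1 - h2
  have e2 : (1 - Ph (t + 1) + X * Ph (t + 1) ^ 2) * Ph (t + 2) = Ph (t + 2) - Ph (t + 1) := by
    linear_combination (-Ph (t + 1)) * h2
  have e3 : Ph (t + 1) * (X * (Ph (t + 2) - Ph t)) = Ph (t + 1) * ((1 - Ph (t + 1) + X * Ph (t + 1) ^ 2) +
      (1 - Ph (t + 1) + X * Ph (t + 1) ^ 2) * (X * (Ph (t + 2) - Ph t))) := by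
    linear_combination (1 - (1 - Ph (t + 1) + X * Ph (t + 1) ^ 2)) * e1 - e2
  have hf : Ph (t + 1) * (1 - X * Ph t) = 1 := by linear_combination h1
  generalize X * (Ph (t + 2) - Ph t) = L at *
  generalize 1 - Ph (t + 1) + X * Ph (t + 1) ^ 2 = x at *
  linear_combination (1 - X * Ph t) * e3 - (L - (x + x * L)) * hf

/-! inverses -/

noncomputable def i1 : ℚ⟦X⟧ := (1 - X)⁻¹
noncomputable def iv : ℚ⟦X⟧ := (1 - 2 * X)⁻¹
noncomputable def i3 : ℚ⟦X⟧ := (1 - 3 * X)⁻¹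
noncomputable def ik : ℚ⟦X⟧ := (1 - 4 * X + 2 * X ^ 2)⁻¹

theorem i1_mul : (1 - X) * i1 = 1 := PowerSeries.mul_inv_cancel _ (by simp)
theorem iv_mul : (1 - 2 * X) * iv = 1 := PowerSeries.mul_inv_cancel _ (by simp)
theorem i3_mul : (1 - 3 * X) * i3 = 1 := PowerSeries.mul_inv_cancel _ (by simp)
theorem ik_mul : (1 - 4 * X + 2 * X ^ 2) * ik = 1 := PowerSeries.mul_inv_cancel _ (by simp)

theorem NN_two : NN 2 := by
  have := NN_one.add NN_one
  rwa [one_add_one_eq_two] at this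

theorem NN_three : NN 3 := by
  have := NN_two.add NN_one
  rwa [two_add_one_eq_three] at this

theorem NN_i1 : NN i1 := NN_of_inv NN_one (by linear_combination i1_mul)
theorem NN_iv : NN iv := NN_of_inv NN_two (by linear_combination iv_mul)
theorem NN_i3 : NN i3 := NN_of_inv NN_three (by linear_combination i3_mul)

theorem v_ik : (1 - 2 * X) * ik = iv + 2 * X ^ 2 * iv * ik := by
  linear_combination iv * ik_mul - (1 - 2 * X) * ik * iv_mul

theorem NN_ik : NN ik := by
  have h1 : NN ((1 - 2 * X) ^ 2 * ik) := by
    refine NN_of_inv (q := X * (2 * iv ^ 2)) (NN_X.mul (NN_two.mul (NN_iv.pow 2))) ?_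
    linear_combination ik_mul - 2 * X ^ 2 * ik * ((1 - 2 * X) * iv + 1) * iv_mul
  have h2 : ik = iv ^ 2 * ((1 - 2 * X) ^ 2 * ik) := by
    linear_combination (-ik * ((1 - 2 * X) * iv + 1)) * iv_mul
  rw [h2]
  exact (NN_iv.pow 2).mul h1

theorem NN_v_ik : NN ((1 - 2 * X) * ik) := by
  rw [v_ik]
  exact NN_iv.add (((NN_two.mul (NN_X.pow 2)).mul NN_iv).mul NN_ik)

theorem two_v_im : 2 * ((1 - 2 * X) * (i1 * i3)) = i1 + i3 := by
  linear_combination i3 * i1_mul + i1 * i3_mul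

theorem NN_nat (n : ℕ) : NN (n : ℚ⟦X⟧) := by
  induction n with
  | zero => simpa using NN_zero
  | succ n ih => rw [Nat.cast_succ]; exact ih.add NN_one

noncomputable def Cc : ℚ⟦X⟧ := (3 + 2 * iv) * (i1 * i3)

theorem NN_Cc : NN Cc := (NN_three.add (NN_two.mul NN_iv)).mul (NN_i1.mul NN_i3)

theorem NN_v_Cc : NN (2 * ((1 - 2 * X) * Cc)) := by
  have : 2 * ((1 - 2 * X) * Cc) = (3 + 2 * iv) * (i1 + i3) := by
    rw [← two_v_im]; unfold Cc; ring
  rw [this]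
  exact (NN_three.add (NN_two.mul NN_iv)).mul (NN_i1.add NN_i3)

noncomputable def F3op (e1 e3 : ℚ⟦X⟧) : ℚ⟦X⟧ := e3 - 3 * (1 - 4 * X) * e1
noncomputable def F5op (e1 e3 e5 : ℚ⟦X⟧) : ℚ⟦X⟧ :=
  3 * e5 + 15 * (1 - 4 * X) ^ 2 * e1 - 10 * (1 - 4 * X) * e3
noncomputable def F7op (e1 e3 e5 e7 : ℚ⟦X⟧) : ℚ⟦X⟧ :=
  5 * e7 - 35 * (1 - 4 * X) ^ 3 * e1 - 35 * (1 - 4 * X) ^ 2 * F3op e1 e3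
    - 7 * (1 - 4 * X) * F5op e1 e3 e5
/-- `6720` times the upper bound series -/
noncomputable def Uop (e1 e3 e5 : ℚ⟦X⟧) : ℚ⟦X⟧ :=
  3360 * e1 - 560 * iv * F3op e1 e3 + 14 * Cc * F5op e1 e3 e5
/-- `6720` times the error series -/
noncomputable def Eop (e1 e3 e5 e7 : ℚ⟦X⟧) : ℚ⟦X⟧ :=
  3 * Cc * ik * F7op e1 e3 e5 e7 + 6 * (ik * iv * F7op e1 e3 e5 e7)

noncomputable def et (i t : ℕ) : ℚ⟦X⟧ := els t ^ i - els (t + 2) ^ i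

theorem et1 (t : ℕ) : et 1 t = 2 * ys t := by rw [et, pow_one, pow_one, els_sub]

theorem et3 (t : ℕ) : et 3 t = 2 * ys t * ((2 * ys t) ^ 2 +
    3 * ((1 - 4 * X) + 2 * (1 - 2 * X) * ys t)) := by
  rw [← els_sub, ← els_mul]; unfold et; ring

theorem et5 (t : ℕ) : et 5 t = 2 * ys t * ((2 * ys t) ^ 4 +
    5 * (2 * ys t) ^ 2 * ((1 - 4 * X) + 2 * (1 - 2 * X) * ys t) +
    5 * ((1 - 4 * X) + 2 * (1 - 2 * X) * ys t) ^ 2) := by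
  rw [← els_sub, ← els_mul]; unfold et; ring

theorem et7 (t : ℕ) : et 7 t = 2 * ys t * ((2 * ys t) ^ 6 +
    7 * (2 * ys t) ^ 4 * ((1 - 4 * X) + 2 * (1 - 2 * X) * ys t) +
    14 * (2 * ys t) ^ 2 * ((1 - 4 * X) + 2 * (1 - 2 * X) * ys t) ^ 2 +
    7 * ((1 - 4 * X) + 2 * (1 - 2 * X) * ys t) ^ 3) := by
  rw [← els_sub, ← els_mul]; unfold et; ring

theorem F3_t (t : ℕ) : F3op (et 1 t) (et 3 t) = 12 * (1 - 2 * X) * ys t ^ 2 + 8 * ys t ^ 3 := by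
  rw [F3op, et3, et1]; ring

theorem F5_t (t : ℕ) : F5op (et 1 t) (et 3 t) (et 5 t) =
    160 * ((1 - X) * (1 - 3 * X)) * ys t ^ 3 + 240 * (1 - 2 * X) * ys t ^ 4
      + 96 * ys t ^ 5 := by
  rw [F5op, et3, et1, et5]; ring

theorem F7_t (t : ℕ) : F7op (et 1 t) (et 3 t) (et 5 t) (et 7 t) =
    1120 * (1 - 2 * X) * (1 - 4 * X + 2 * X ^ 2) * ys t ^ 4 +
      2688 * (1 - 4 * X + 2 * X ^ 2) * ys t ^ 5 + 3584 * X ^ 2 * ys t ^ 5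
      + 2240 * (1 - 2 * X) * ys t ^ 6 + 640 * ys t ^ 7 := by
  rw [F7op, F3_t, F5_t, et7, et1]; ring

theorem xs_exp (t : ℕ) : ys t - ys t ^ 2 + ys t ^ 3 - gs (t + 1) = gs (t + 1) * ys t ^ 3 := by
  linear_combination (1 - ys t + ys t ^ 2) * xs_eq t

theorem U_t (t : ℕ) : Uop (et 1 t) (et 3 t) (et 5 t) - 6720 * gs (t + 1) =
    14 * Cc * (240 * (1 - 2 * X) * ys t ^ 4 + 96 * ys t ^ 5) + 6720 * (gs (t + 1) * ys t ^ 3) := by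
  rw [Uop, F3_t, F5_t, et1, ← xs_exp, Cc]
  have h1 := i1_mul
  have h3 := i3_mul
  have hv := iv_mul
  have hm : (1 - X) * (1 - 3 * X) * (i1 * i3) = 1 := by
    linear_combination (1 - 3 * X) * i3 * h1 + h3
  linear_combination (-6720 * ys t ^ 2) * hv + 14 * (3 + 2 * iv) * 160 * ys t ^ 3 * hm

theorem E_t (t : ℕ) : Eop (et 1 t) (et 3 t) (et 5 t) (et 7 t) -
    (Uop (et 1 t) (et 3 t) (et 5 t) - 6720 * gs (t + 1)) =
    Cc * (6720 * ys t ^ 5 + 10752 * (X ^ 2 * ik) * ys t ^ 5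
      + 6720 * ((1 - 2 * X) * ik) * ys t ^ 6 + 1920 * ik * ys t ^ 7)
    + (16128 * iv * ys t ^ 5 + 21504 * (X ^ 2 * ik * iv) * ys t ^ 5 + 13440 * ik * ys t ^ 6
      + 3840 * (ik * iv) * ys t ^ 7)
    + 6720 * (ys t ^ 4 * gs (t + 1)) := by
  rw [U_t, Eop, F7_t]
  have hv := iv_mul
  have hk := ik_mul
  have hkv : (1 - 4 * X + 2 * X ^ 2) * ik * ((1 - 2 * X) * iv) = 1 := by
    linear_combination (1 - 2 * X) * iv * hk + hv
  linear_combination (3 * Cc * (1120 * (1 - 2 * X) * ys t ^ 4 + 2688 * ys t ^ 5)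
      + 6 * iv * 2688 * ys t ^ 5) * hk +
    6720 * ys t ^ 4 * hkv + 13440 * ik * ys t ^ 6 * hv + 6720 * ys t ^ 3 * xs_eq t

theorem NN_ofNat (n : ℕ) [n.AtLeastTwo] : NN (OfNat.ofNat n : ℚ⟦X⟧) := by
  have := NN_nat n
  rwa [← Nat.cast_ofNat (R := ℚ⟦X⟧)]

theorem NN_U_t (t : ℕ) : NN (Uop (et 1 t) (et 3 t) (et 5 t) - 6720 * gs (t + 1)) := by
  rw [U_t]
  have : 14 * Cc * (240 * (1 - 2 * X) * ys t ^ 4 + 96 * ys t ^ 5) =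
     1680 * (2 * ((1 - 2 * X) * Cc)) * ys t ^ 4 + 14 * Cc * (96 * ys t ^ 5) := by ring
  rw [this]
  have hy := NN_ys t
  exact ((((NN_ofNat _).mul NN_v_Cc).mul (hy.pow 4)).add
    (((NN_ofNat _).mul NN_Cc).mul ((NN_ofNat _).mul (hy.pow 5)))).add
    ((NN_ofNat _).mul ((NN_gs _).mul (hy.pow 3)))

theorem NN_E_t (t : ℕ) : NN (Eop (et 1 t) (et 3 t) (et 5 t) (et 7 t) -
    (Uop (et 1 t) (et 3 t) (et 5 t) - 6720 * gs (t + 1))) := by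
  rw [E_t]
  have hy := NN_ys t
  have hX := NN_X.pow 2
  refine ((NN_Cc.mul ?_).add ?_).add ((NN_ofNat _).mul ((hy.pow 4).mul (NN_gs _)))
  · exact ((((NN_ofNat _).mul (hy.pow 5)).add
      (((NN_ofNat _).mul (hX.mul NN_ik)).mul (hy.pow 5))).add
      (((NN_ofNat _).mul NN_v_ik).mul (hy.pow 6))).add (((NN_ofNat _).mul NN_ik).mul (hy.pow 7))
  · exact (((((NN_ofNat _).mul NN_iv).mul (hy.pow 5)).add
      (((NN_ofNat _).mul ((hX.mul NN_ik).mul NN_iv)).mul (hy.pow 5))).add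
      (((NN_ofNat _).mul NN_ik).mul (hy.pow 6))).add
      (((NN_ofNat _).mul (NN_ik.mul NN_iv)).mul (hy.pow 7))

/-! summation over `t < H` -/

noncomputable def EH (i H : ℕ) : ℚ⟦X⟧ := 1 + (1 - 2 * X) ^ i - els H ^ i - els (H + 1) ^ i

theorem els_zero : els 0 = 1 := by simp [els, Ph_zero]

theorem Ph_one : Ph 1 = 1 := by rw [Ph_succ 0, Ph_zero]; ring

theorem els_one : els 1 = 1 - 2 * X := by simp [els, Ph_one]

theorem EH_zero (i : ℕ) : EH i 0 = 0 := by
  rw [EH, els_zero, els_one]; ring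

theorem EH_succ (i H : ℕ) : EH i (H + 1) = EH i H + et i H := by
  rw [EH, EH, et]; ring

theorem Uop_add (a b c a' b' c' : ℚ⟦X⟧) :
    Uop (a + a') (b + b') (c + c') = Uop a b c + Uop a' b' c' := by
  unfold Uop F3op F5op; ring

theorem Eop_add (a b c d a' b' c' d' : ℚ⟦X⟧) :
    Eop (a + a') (b + b') (c + c') (d + d') = Eop a b c d + Eop a' b' c' d' := by
  unfold Eop F7op F3op F5op; ring

theorem NN_U_H (H : ℕ) : NN (Uop (EH 1 H) (EH 3 H) (EH 5 H) -
    6720 * ∑ t ∈ range H, gs (t + 1)) := by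
  induction H with
  | zero => simp [EH_zero, Uop, F3op, F5op, NN_zero]
  | succ H ih =>
    rw [EH_succ, EH_succ, EH_succ, Uop_add, Finset.sum_range_succ, mul_add, add_sub_add_comm]
    exact ih.add (NN_U_t H)

theorem NN_E_H (H : ℕ) : NN (Eop (EH 1 H) (EH 3 H) (EH 5 H) (EH 7 H) -
    (Uop (EH 1 H) (EH 3 H) (EH 5 H) - 6720 * ∑ t ∈ range H, gs (t + 1))) := by
  induction H with
  | zero => simp [EH_zero, Uop, Eop, F7op, F3op, F5op, NN_zero]
  | succ H ih =>
    rw [EH_succ, EH_succ, EH_succ, EH_succ, Uop_add, Eop_add, Finset.sum_range_succ, mul_add,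
      add_sub_add_comm (Uop _ _ _), add_sub_add_comm]
    exact ih.add (NN_E_t H)

/-! passing to the limit -/

noncomputable def Cat : ℚ⟦X⟧ := PowerSeries.mk fun n => (catalan n : ℚ)

theorem Cat_eq : Cat = 1 + X * (Cat * Cat) := by
  ext n
  cases n with
  | zero => simp [Cat]
  | succ n =>
    rw [map_add, PowerSeries.coeff_succ_X_mul, PowerSeries.coeff_mul, PowerSeries.coeff_one]
    simp [Cat, catalan_succ']

theorem dvd_Ph (h : ℕ) : (X : ℚ⟦X⟧) ^ h ∣ Ph h - Cat := by
  induction h with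
  | zero => simp
  | succ h ih =>
    have : Ph (h + 1) - Cat = X * (Ph h - Cat) * (Ph (h + 1) * Cat) := by
      have h1 := Ph_succ h
      have h2 := Cat_eq
      linear_combination Cat * h1 - Ph (h + 1) * h2
    rw [this, pow_succ']
    exact (mul_dvd_mul_left _ ih).mul_right _

noncomputable def Wr : ℚ⟦X⟧ := 1 - 2 * X * Cat

theorem Wr_sq : Wr ^ 2 = 1 - 4 * X := by
  unfold Wr
  linear_combination (-4 * X) * Cat_eq

theorem dvd_els (h i : ℕ) : (X : ℚ⟦X⟧) ^ (h + 1) ∣ els h ^ i - Wr ^ i := by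
  refine dvd_trans ?_ (sub_dvd_pow_sub_pow _ _ _)
  have : els h - Wr = X * (Ph h - Cat) * (-2) := by unfold els Wr; ring
  rw [this, pow_succ']
  exact (mul_dvd_mul_left _ (dvd_Ph h)).mul_right _

noncomputable def EI (i : ℕ) : ℚ⟦X⟧ := 1 + (1 - 2 * X) ^ i - 2 * Wr ^ i

theorem dvd_EH (h i : ℕ) : (X : ℚ⟦X⟧) ^ (h + 1) ∣ EH i h - EI i := by
  have : EH i h - EI i = -((els h ^ i - Wr ^ i) + (els (h + 1) ^ i - Wr ^ i)) := by
    unfold EH EI; ring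
  rw [this, dvd_neg]
  exact (dvd_els h i).add ((pow_dvd_pow _ (by omega)).trans (dvd_els (h + 1) i))

theorem dvd_Uop {d a b c : ℚ⟦X⟧} (ha : d ∣ a) (hb : d ∣ b) (hc : d ∣ c) : d ∣ Uop a b c := by
  obtain ⟨a, rfl⟩ := ha
  obtain ⟨b, rfl⟩ := hb
  obtain ⟨c, rfl⟩ := hc
  exact ⟨Uop a b c, by unfold Uop F3op F5op; ring⟩

theorem dvd_Eop {d a b c e : ℚ⟦X⟧} (ha : d ∣ a) (hb : d ∣ b) (hc : d ∣ c) (he : d ∣ e) :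
    d ∣ Eop a b c e := by
  obtain ⟨a, rfl⟩ := ha
  obtain ⟨b, rfl⟩ := hb
  obtain ⟨c, rfl⟩ := hc
  obtain ⟨e, rfl⟩ := he
  exact ⟨Eop a b c e, by unfold Eop F7op F3op F5op; ring⟩

noncomputable def UI : ℚ⟦X⟧ := Uop (EI 1) (EI 3) (EI 5)
noncomputable def ErI : ℚ⟦X⟧ := Eop (EI 1) (EI 3) (EI 5) (EI 7)

theorem coeff_UI (n : ℕ) : coeff n (Uop (EH 1 n) (EH 3 n) (EH 5 n)) = coeff n UI := by
  have h : (X : ℚ⟦X⟧) ^ (n + 1) ∣ Uop (EH 1 n - EI 1) (EH 3 n - EI 3) (EH 5 n - EI 5) :=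
    dvd_Uop (dvd_EH _ _) (dvd_EH _ _) (dvd_EH _ _)
  have h2 := Uop_add (EH 1 n - EI 1) (EH 3 n - EI 3) (EH 5 n - EI 5) (EI 1) (EI 3) (EI 5)
  simp only [sub_add_cancel] at h2
  rw [h2, map_add, PowerSeries.X_pow_dvd_iff.mp h n (Nat.lt_succ_self n), zero_add, UI]

theorem coeff_ErI (n : ℕ) : coeff n (Eop (EH 1 n) (EH 3 n) (EH 5 n) (EH 7 n)) = coeff n ErI := by
  have h : (X : ℚ⟦X⟧) ^ (n + 1) ∣
      Eop (EH 1 n - EI 1) (EH 3 n - EI 3) (EH 5 n - EI 5) (EH 7 n - EI 7) :=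
    dvd_Eop (dvd_EH _ _) (dvd_EH _ _) (dvd_EH _ _) (dvd_EH _ _)
  have h2 := Eop_add (EH 1 n - EI 1) (EH 3 n - EI 3) (EH 5 n - EI 5) (EH 7 n - EI 7)
    (EI 1) (EI 3) (EI 5) (EI 7)
  simp only [sub_add_cancel] at h2
  rw [h2, map_add, PowerSeries.X_pow_dvd_iff.mp h n (Nat.lt_succ_self n), zero_add, ErI]

theorem numA_coeff (n : ℕ) : (numA (n + 1) : ℚ) =
    coeff (n + 1) (∑ t ∈ range (n + 1), gs (t + 1)) := by
  rw [numA_eq (n + 1) (n + 1) le_rfl, Finset.sum_range_succ']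
  simp [uq_succ_zero, gs]

theorem numA_le (n : ℕ) : 6720 * (numA (n + 1) : ℚ) ≤ coeff (n + 1) UI := by
  have := NN_U_H (n + 1) (n + 1)
  rw [map_sub, coeff_UI, ← Nat.cast_ofNat (R := ℚ⟦X⟧), ← nsmul_eq_mul, map_nsmul, ← numA_coeff,
    nsmul_eq_mul] at this
  push_cast at this
  linarith

theorem le_numA (n : ℕ) : coeff (n + 1) UI - coeff (n + 1) ErI ≤ 6720 * (numA (n + 1) : ℚ) := by
  have := NN_E_H (n + 1) (n + 1)
  rw [map_sub, map_sub, coeff_UI, coeff_ErI, ← Nat.cast_ofNat (R := ℚ⟦X⟧), ← nsmul_eq_mul,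
    map_nsmul, ← numA_coeff, nsmul_eq_mul] at this
  push_cast at this
  linarith

end LISProof

namespace LISProof

open Finset PowerSeries

noncomputable def us : ℚ⟦X⟧ := Cat - 1

theorem us_eq : us = X * (1 + us) ^ 2 := by
  unfold us; linear_combination Cat_eq

theorem X_dvd_us : (X : ℚ⟦X⟧) ∣ us := ⟨_, us_eq⟩

theorem X_pow_dvd_us {m e : ℕ} (h : m ≤ e) : (X : ℚ⟦X⟧) ^ m ∣ us ^ e :=
  (pow_dvd_pow _ h).trans (pow_dvd_pow_of_dvd X_dvd_us e)

theorem Ph_us (k : ℕ) : Ph k * (1 - us ^ (k + 1)) = (1 + us) * (1 - us ^ k) := by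
  induction k with
  | zero => simp [Ph_zero]
  | succ k ih =>
    have h1 := Ph_succ k
    have hu := us_eq
    have e : (1 + us) * (1 - us ^ (k + 1)) * (1 - X * Ph k) = 1 - us ^ (k + 2) := by
      have hp : us ^ (k + 1) = us * us ^ k := by ring
      have hp2 : us ^ (k + 2) = us * us * us ^ k := by ring
      rw [hp] at ih
      rw [hp, hp2]
      linear_combination (-(1 + us) * X) * ih + (1 - us ^ k) * hu
    have h1' : Ph (k + 1) * (1 - X * Ph k) = 1 := by linear_combination h1
    rw [show k + 1 + 1 = k + 2 from rfl, ← e]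
    linear_combination (1 + us) * (1 - us ^ (k + 1)) * h1'

theorem gs_us (k : ℕ) : gs k * (1 - us ^ (k + 1)) ^ 2 = (1 - us) ^ 2 * us ^ k := by
  induction k with
  | zero => simp [gs_zero]
  | succ k ih =>
    have h := Ph_us (k + 1)
    have hu := us_eq
    rw [gs_succ']
    calc X * Ph (k + 1) ^ 2 * gs k * (1 - us ^ (k + 1 + 1)) ^ 2
        = X * (Ph (k + 1) * (1 - us ^ (k + 1 + 1))) ^ 2 * gs k := by ring
      _ = (X * (1 + us) ^ 2) * (gs k * (1 - us ^ (k + 1)) ^ 2) := by rw [h]; ring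
      _ = _ := by rw [ih, ← hu]; ring

theorem geom2 (q : ℚ⟦X⟧) (M : ℕ) : (∑ i ∈ range M, ((i : ℚ⟦X⟧) + 1) * q ^ i) * (1 - q) ^ 2 =
    1 - q ^ M * ((M + 1) - M * q) := by
  induction M with
  | zero => simp
  | succ M ih => rw [Finset.sum_range_succ, add_mul, ih]; push_cast; ring

theorem dvd_gs (k M : ℕ) : (X : ℚ⟦X⟧) ^ M ∣ gs k - (1 - us) ^ 2 *
    ∑ i ∈ range M, ((i : ℚ⟦X⟧) + 1) * us ^ (k + (k + 1) * i) := by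
  have hun : IsUnit ((1 - us ^ (k + 1)) ^ 2) := by
    apply IsUnit.pow
    rw [PowerSeries.isUnit_iff_constantCoeff]
    have : constantCoeff us = 0 := PowerSeries.X_dvd_iff.mp X_dvd_us
    simp [this]
  rw [← hun.dvd_mul_right]
  have hs : ∑ i ∈ range M, ((i : ℚ⟦X⟧) + 1) * us ^ (k + (k + 1) * i) =
      us ^ k * ∑ i ∈ range M, ((i : ℚ⟦X⟧) + 1) * (us ^ (k + 1)) ^ i := by
    rw [Finset.mul_sum]
    refine Finset.sum_congr rfl fun i _ => ?_
    rw [pow_add, pow_mul]; ring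
  rw [hs]
  have e : (gs k - (1 - us) ^ 2 * (us ^ k * ∑ i ∈ range M, ((i : ℚ⟦X⟧) + 1) * (us ^ (k + 1)) ^ i))
      * (1 - us ^ (k + 1)) ^ 2 = us ^ ((k + 1) * M) *
        ((1 - us) ^ 2 * us ^ k * ((M + 1) - M * us ^ (k + 1))) := by
    rw [pow_mul]
    linear_combination gs_us k - (1 - us) ^ 2 * us ^ k * geom2 (us ^ (k + 1)) M
  rw [e]
  exact (X_pow_dvd_us (Nat.le_mul_of_pos_left _ (Nat.succ_pos k))).mul_right _

def sg (j : ℕ) : ℕ → ℕ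
  | 0 => 0
  | i + 1 => if (j + 1) % (i + 1) = 0 then sg j i + (i + 1) else sg j i

theorem sg_eq (j M : ℕ) : sg j M = ∑ i ∈ range M, if (i + 1) ∣ (j + 1) then i + 1 else 0 := by
  induction M with
  | zero => rfl
  | succ M ih =>
    rw [Finset.sum_range_succ, ← ih, sg]
    simp only [Nat.dvd_iff_mod_eq_zero]
    split_ifs <;> rfl

theorem inner_sg (j M i : ℕ) (hj : j < M) :
    (∑ k ∈ range M, if k + (k + 1) * i = j then ((i : ℚ⟦X⟧) + 1) else 0) =
      (((if (i + 1) ∣ (j + 1) then i + 1 else 0 : ℕ)) : ℚ⟦X⟧) := by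
  split_ifs with hd
  · obtain ⟨c, hc⟩ := hd
    have hc0 : 0 < c := by
      rcases Nat.eq_zero_or_pos c with h | h
      · subst h; omega
      · exact h
    obtain ⟨k, rfl⟩ : ∃ k, c = k + 1 := ⟨c - 1, by omega⟩
    have hk : ∀ k', k' + (k' + 1) * i = j ↔ k' = k := by
      intro k'
      constructor
      · intro h
        have : (i + 1) * (k' + 1) = (i + 1) * (k + 1) := by rw [← hc, ← h]; ring
        have := Nat.eq_of_mul_eq_mul_left (Nat.succ_pos i) this
        omega
      · rintro rfl
        have : k' + (k' + 1) * i + 1 = (i + 1) * (k' + 1) := by ring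
        omega
    simp only [hk]
    rw [Finset.sum_ite_eq' (range M) k]
    have : k ∈ range M := by
      rw [Finset.mem_range]
      have : k + 1 ≤ (i + 1) * (k + 1) := Nat.le_mul_of_pos_left _ (Nat.succ_pos i)
      omega
    rw [if_pos this]; push_cast; rfl
  · rw [Nat.cast_zero]
    apply Finset.sum_eq_zero
    intro k _
    rw [if_neg]
    intro h
    apply hd
    exact ⟨k + 1, by rw [← h]; ring⟩

theorem term_dvd (M e : ℕ) (c : ℚ⟦X⟧) : (X : ℚ⟦X⟧) ^ M ∣ c * us ^ e -
    ∑ j ∈ range M, (if e = j then c else 0) * us ^ j := by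
  by_cases h : e < M
  · have : ∑ j ∈ range M, (if e = j then c else 0) * us ^ j = c * us ^ e := by
      simp only [ite_mul, zero_mul]
      rw [Finset.sum_ite_eq (range M) e, if_pos (Finset.mem_range.mpr h)]
    rw [this, sub_self]; exact dvd_zero _
  · have : ∑ j ∈ range M, (if e = j then c else 0) * us ^ j = 0 := by
      apply Finset.sum_eq_zero
      intro j hj
      rw [Finset.mem_range] at hj
      rw [if_neg (by omega), zero_mul]
    rw [this, sub_zero]
    exact (X_pow_dvd_us (by omega)).mul_left _

theorem dvd_S (M : ℕ) : (X : ℚ⟦X⟧) ^ M ∣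
    (∑ k ∈ range M, gs k) - (1 - us) ^ 2 * ∑ j ∈ range M, (sg j M : ℚ⟦X⟧) * us ^ j := by
  have h1 : ∑ j ∈ range M, (sg j M : ℚ⟦X⟧) * us ^ j = ∑ k ∈ range M, ∑ i ∈ range M,
      ∑ j ∈ range M, (if k + (k + 1) * i = j then ((i : ℚ⟦X⟧) + 1) else 0) * us ^ j := by
    rw [Finset.sum_comm]
    have : ∀ i ∈ range M, (∑ k ∈ range M, ∑ j ∈ range M,
        (if k + (k + 1) * i = j then ((i : ℚ⟦X⟧) + 1) else 0) * us ^ j) =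
        ∑ j ∈ range M, (((if (i + 1) ∣ (j + 1) then i + 1 else 0 : ℕ)) : ℚ⟦X⟧) * us ^ j := by
      intro i _
      rw [Finset.sum_comm]
      refine Finset.sum_congr rfl fun j hj => ?_
      rw [← inner_sg j M i (Finset.mem_range.mp hj), Finset.sum_mul]
    rw [Finset.sum_congr rfl this, Finset.sum_comm]
    refine Finset.sum_congr rfl fun j _ => ?_
    rw [sg_eq, Nat.cast_sum, Finset.sum_mul]
  rw [h1, Finset.mul_sum, ← Finset.sum_sub_distrib]
  refine Finset.dvd_sum fun k _ => ?_
  have := dvd_gs k M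
  have h2 : (X : ℚ⟦X⟧) ^ M ∣ (1 - us) ^ 2 * ∑ i ∈ range M, (((i : ℚ⟦X⟧) + 1) * us ^ (k + (k + 1) * i)
      - ∑ j ∈ range M, (if k + (k + 1) * i = j then ((i : ℚ⟦X⟧) + 1) else 0) * us ^ j) :=
    (Finset.dvd_sum fun i _ => term_dvd M _ _).mul_left _
  have h3 := this.add h2
  rw [Finset.sum_sub_distrib, mul_sub, sub_add_sub_cancel] at h3
  exact h3

/-! list computations -/

noncomputable def val : List ℕ → ℚ⟦X⟧
  | [] => 0
  | a :: l => (a : ℚ⟦X⟧) + us * val l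

theorem val_append (l : List ℕ) (a : ℕ) : val (l ++ [a]) = val l + a * us ^ l.length := by
  induction l with
  | nil => simp [val]
  | cons b l ih => rw [List.cons_append, val, val, ih, List.length_cons]; ring

theorem val_range (f : ℕ → ℕ) (M : ℕ) :
    val ((List.range M).map f) = ∑ j ∈ range M, (f j : ℚ⟦X⟧) * us ^ j := by
  induction M with
  | zero => simp [val]
  | succ M ih =>
    rw [List.range_succ, List.map_append, List.map_singleton, val_append, ih,
      Finset.sum_range_succ]
    simp

/-- multiplication by `1 + u`, keeping the length -/
def m1 (p : ℕ) : List ℕ → List ℕ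
  | [] => []
  | a :: l => (p + a) :: m1 a l

theorem m1_length (p : ℕ) (l : List ℕ) : (m1 p l).length = l.length := by
  induction l generalizing p with
  | nil => rfl
  | cons a l ih => rw [m1, List.length_cons, List.length_cons, ih]

theorem m1_dvd (p : ℕ) (l : List ℕ) : (X : ℚ⟦X⟧) ^ l.length ∣
    (p : ℚ⟦X⟧) + (1 + us) * val l - val (m1 p l) := by
  induction l generalizing p with
  | nil => simp
  | cons a l ih =>
    have : (p : ℚ⟦X⟧) + (1 + us) * val (a :: l) - val (m1 p (a :: l)) =
        us * ((a : ℚ⟦X⟧) + (1 + us) * val l - val (m1 a l)) := by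
      rw [m1, val, val]; push_cast; ring
    rw [this, List.length_cons, pow_succ']
    exact mul_dvd_mul X_dvd_us (ih a)

def m2 (l : List ℕ) : List ℕ := m1 0 (m1 0 l)

theorem m2_length (l : List ℕ) : (m2 l).length = l.length := by
  rw [m2, m1_length, m1_length]

theorem m2_dvd (l : List ℕ) : (X : ℚ⟦X⟧) ^ l.length ∣ (1 + us) ^ 2 * val l - val (m2 l) := by
  have h1 := m1_dvd 0 l
  have h2 := m1_dvd 0 (m1 0 l)
  rw [m1_length] at h2
  have h3 := (h1.mul_left (1 + us)).add h2
  have : (1 + us) ^ 2 * val l - val (m2 l) = (1 + us) * (((0 : ℕ) : ℚ⟦X⟧) + (1 + us) * val l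
      - val (m1 0 l)) + (((0 : ℕ) : ℚ⟦X⟧) + (1 + us) * val (m1 0 l) - val (m1 0 (m1 0 l))) := by
    rw [m2]; push_cast; ring
  rw [this]; exact h3

/-- the coefficients of `G` from index `n` on are modelled by `l` -/
def Model (G : ℚ⟦X⟧) (n : ℕ) (l : List ℕ) : Prop :=
  (X : ℚ⟦X⟧) ^ l.length ∣ (PowerSeries.mk fun i => coeff (n + i) G) - val l

theorem coeff_us_zero : constantCoeff us = 0 := PowerSeries.X_dvd_iff.mp X_dvd_us

theorem Model.head {G : ℚ⟦X⟧} {n a : ℕ} {l : List ℕ} (h : Model G n (a :: l)) :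
    coeff n G = a := by
  have h0 := PowerSeries.X_pow_dvd_iff.mp h 0 (by simp)
  rw [val] at h0
  simp [coeff_us_zero] at h0
  linarith

theorem Model.step {G : ℚ⟦X⟧} {n a : ℕ} {l : List ℕ} (h : Model G n (a :: l)) :
    Model G (n + 1) (m2 l) := by
  have hh := h.head
  unfold Model at *
  rw [m2_length]
  have e : (PowerSeries.mk fun i => coeff (n + i) G) - val (a :: l) =
      X * ((PowerSeries.mk fun i => coeff (n + 1 + i) G) - (1 + us) ^ 2 * val l) := by
    have e1 : (PowerSeries.mk fun i => coeff (n + i) G) = (a : ℚ⟦X⟧) +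
        X * (PowerSeries.mk fun i => coeff (n + 1 + i) G) := by
      ext i
      cases i with
      | zero => simp [hh]
      | succ i =>
        rw [map_add, PowerSeries.coeff_succ_X_mul, PowerSeries.coeff_mk, PowerSeries.coeff_mk,
          ← map_natCast (C (R := ℚ)), PowerSeries.coeff_C, if_neg (Nat.succ_ne_zero i), zero_add]
        congr 2
        omega
    rw [e1, val]
    have hu := us_eq
    linear_combination (-val l) * hu
  rw [e, List.length_cons, pow_succ'] at h
  have h2 := (mul_dvd_mul_iff_left (PowerSeries.X_ne_zero (R := ℚ))).mp h
  have h3 := h2.add (m2_dvd l)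
  rwa [sub_add_sub_cancel] at h3

noncomputable def Ms (M : ℕ) : ℚ⟦X⟧ := (1 + us) ^ 2 * ∑ j ∈ range M, (sg j M : ℚ⟦X⟧) * us ^ j

def start (M : ℕ) : List ℕ := m2 ((List.range M).map fun j => sg j M)

theorem start_model (M : ℕ) : Model (Ms M) 0 (start M) := by
  unfold Model
  have := m2_dvd ((List.range M).map fun j => sg j M)
  rw [val_range] at this
  rw [start, m2_length]
  convert this using 2
  ext i
  simp [Ms]

theorem numA_Ms (M n : ℕ) (hn : n + 1 < M) :
    (numA (n + 1) : ℚ) = coeff (n + 1) (Ms M) - 4 * coeff n (Ms M) := by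
  have h := PowerSeries.X_pow_dvd_iff.mp (dvd_S M) (n + 1) hn
  have e : (1 - us) ^ 2 * ∑ j ∈ range M, (sg j M : ℚ⟦X⟧) * us ^ j = Ms M - X * (4 * Ms M) := by
    unfold Ms
    have hu := us_eq
    linear_combination (-4 * ∑ j ∈ range M, (sg j M : ℚ⟦X⟧) * us ^ j) * hu
  rw [e, map_sub, map_sub, PowerSeries.coeff_succ_X_mul, ← Nat.cast_ofNat (R := ℚ⟦X⟧),
    ← nsmul_eq_mul, map_nsmul, nsmul_eq_mul] at h
  obtain ⟨N, rfl⟩ : ∃ N, M = N + 1 := ⟨M - 1, by omega⟩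
  have h2 : (numA (n + 1) : ℚ) = coeff (n + 1) (∑ k ∈ range (N + 1), gs k) := by
    rw [numA_eq (n + 1) N (by omega)]
    simp [gs]
  rw [h2]
  push_cast at h
  linarith

/-- evaluate a numeral before passing it on -/
def force {α : Type} (x : ℕ) (k : ℕ → α) : α :=
  match x with
  | 0 => k 0
  | m + 1 => k (m + 1)

theorem force_eq {α : Type} (x : ℕ) (k : ℕ → α) : force x k = k x := by
  cases x <;> rfl

def m1k {α : Type} (p : ℕ) (l : List ℕ) (k : List ℕ → α) : α :=
  match l with
  | [] => k []
  | a :: l => force (p + a) fun b => m1k a l fun r => k (b :: r)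

theorem m1k_eq {α : Type} (p : ℕ) (l : List ℕ) (k : List ℕ → α) : m1k p l k = k (m1 p l) := by
  induction l generalizing p k with
  | nil => rfl
  | cons a l ih => rw [m1k, force_eq, ih]; rfl

/-- check the inequality for `fuel` consecutive indices from `n` on; `h0`, `h1` are the
coefficients at `n - 1`, `n`, and `l` describes the coefficients from `n + 1` on -/
def chk : ℕ → ℕ → ℕ → ℕ → List ℕ → Bool
  | 0, _, _, _, _ => true
  | _ + 1, _, _, _, [] => false
  | fuel + 1, n, h0, h1, h2 :: l =>
    Nat.blt ((n + 2) * h2 + 4 * ((4 * n + 2) * h0)) ((4 * n + 2) * h1 + 4 * ((n + 2) * h1)) &&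
      m1k 0 l fun l' => m1k 0 l' fun l'' => chk fuel (n + 1) h1 h2 l''

theorem chk_sound (G : ℚ⟦X⟧) (fuel n h0 h1 : ℕ) (l : List ℕ) (hc : chk fuel (n + 1) h0 h1 l = true)
    (e0 : coeff n G = h0) (e1 : coeff (n + 1) G = h1) (hl : Model G (n + 2) l) (m : ℕ)
    (hm : n ≤ m) (hm2 : m < n + fuel) :
    (m + 3 : ℚ) * (coeff (m + 2) G - 4 * coeff (m + 1) G) <
      (4 * m + 6) * (coeff (m + 1) G - 4 * coeff m G) := by
  induction fuel generalizing n h0 h1 l with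
  | zero => omega
  | succ fuel ih =>
    cases l with
    | nil => simp [chk] at hc
    | cons h2 l =>
      rw [chk, Bool.and_eq_true, m1k_eq, m1k_eq] at hc
      obtain ⟨hc1, hc2⟩ := hc
      rcases Nat.eq_or_lt_of_le hm with rfl | hlt
      · rw [e0, e1, hl.head]
        rw [Nat.blt_eq] at hc1
        have : (((n + 1 + 2) * h2 + 4 * ((4 * (n + 1) + 2) * h0) : ℕ) : ℚ) <
          (((4 * (n + 1) + 2) * h1 + 4 * ((n + 1 + 2) * h1) : ℕ) : ℚ) := by exact_mod_cast hc1
        push_cast at this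
        linarith
      · exact ih (n + 1) h1 h2 _ hc2 e1 hl.head hl.step hlt (by omega)

def chkAll (M fuel : ℕ) : Bool :=
  m1k 0 ((List.range M).map fun j => sg j M) fun l => m1k 0 l fun l' =>
    match l' with
    | _ :: l1 => m1k 0 l1 fun l => m1k 0 l fun l' =>
      match l' with
      | _ :: l2 => m1k 0 l2 fun l => m1k 0 l fun l' =>
        match l' with
        | h0 :: l3 => m1k 0 l3 fun l => m1k 0 l fun l' =>
          match l' with
          | h1 :: l4 => m1k 0 l4 fun l => m1k 0 l fun l' => chk fuel 3 h0 h1 l'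
          | [] => false
        | [] => false
      | [] => false
    | [] => false

theorem chkAll_sound (M fuel : ℕ) (h : chkAll M fuel = true) (m : ℕ) (hm : 2 ≤ m)
    (hm2 : m < 2 + fuel) (hM : m + 2 < M) :
    (m + 3 : ℚ) * numA (m + 2) < (4 * m + 6) * numA (m + 1) := by
  rw [numA_Ms M m (by omega), numA_Ms M (m + 1) (by omega)]
  have hs := start_model M
  unfold chkAll at h
  simp only [m1k_eq] at h
  rw [start, m2] at hs
  generalize m1 0 (m1 0 ((List.range M).map fun j => sg j M)) = l at h hs
  cases l with
  | nil => simp at h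
  | cons a l =>
    have hs1 := hs.step
    dsimp only at h
    rw [m2] at hs1
    generalize m1 0 (m1 0 l) = l at h hs1
    cases l with
    | nil => simp at h
    | cons a l =>
      have hs2 := hs1.step
      dsimp only at h
      rw [m2] at hs2
      generalize m1 0 (m1 0 l) = l at h hs2
      cases l with
      | nil => simp at h
      | cons h0 l =>
        have hs3 := hs2.step
        dsimp only at h
        rw [m2] at hs3
        generalize m1 0 (m1 0 l) = l at h hs3
        cases l with
        | nil => simp at h
        | cons h1 l =>
          exact chk_sound (Ms M) fuel 2 h0 h1 _ h hs2.head hs3.head hs3.step m hm hm2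

theorem chk_run : chkAll 190 180 = true := by decide +kernel

end LISProof

namespace LISProof

open Finset PowerSeries

/-! the explicit series -/

noncomputable def pval : List ℤ → ℚ⟦X⟧
  | [] => 0
  | a :: l => (a : ℚ⟦X⟧) + X * pval l

theorem coeff_intCast_zero (a : ℤ) : coeff 0 (a : ℚ⟦X⟧) = a := by
  rw [← map_intCast (C (R := ℚ)), PowerSeries.coeff_C, if_pos rfl]

theorem coeff_intCast_succ (a : ℤ) (n : ℕ) : coeff (n + 1) (a : ℚ⟦X⟧) = 0 := by
  rw [← map_intCast (C (R := ℚ)), PowerSeries.coeff_C, if_neg (Nat.succ_ne_zero n)]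

theorem coeff_nat_mul (k n : ℕ) (f : ℚ⟦X⟧) : coeff n ((k : ℚ⟦X⟧) * f) = k * coeff n f := by
  rw [← nsmul_eq_mul, map_nsmul, nsmul_eq_mul]

theorem coeff_int_mul (k : ℤ) (n : ℕ) (f : ℚ⟦X⟧) : coeff n ((k : ℚ⟦X⟧) * f) = k * coeff n f := by
  rw [← zsmul_eq_mul, map_zsmul, zsmul_eq_mul]

theorem coeff_pval (l : List ℤ) (n : ℕ) : coeff n (pval l) = (l.getD n 0 : ℤ) := by
  induction l generalizing n with
  | nil => simp [pval]
  | cons a l ih =>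
    rw [pval, map_add]
    cases n with
    | zero => rw [coeff_intCast_zero]; simp
    | succ n => rw [coeff_intCast_succ, PowerSeries.coeff_succ_X_mul, ih]; simp

def L3 : List ℤ := [-4, 24, -12, -8]
def L5 : List ℤ := [16, -160, 480, -160, -80, -96]
def L7 : List ℤ := [-32, 448, -2240, 4480, -1120, -448, -448, -640]

noncomputable def F3 : ℚ⟦X⟧ := F3op (EI 1) (EI 3)
noncomputable def F5 : ℚ⟦X⟧ := F5op (EI 1) (EI 3) (EI 5)
noncomputable def F7 : ℚ⟦X⟧ := F7op (EI 1) (EI 3) (EI 5) (EI 7)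

theorem F3_eq : F3 = pval L3 + ((4 : ℤ) : ℚ⟦X⟧) * Wr ^ 3 := by
  have h := Wr_sq
  simp only [F3, F3op, EI, L3, pval]
  push_cast
  linear_combination (-6 * Wr) * h

theorem F5_eq : F5 = pval L5 + ((-16 : ℤ) : ℚ⟦X⟧) * Wr ^ 5 := by
  have h := Wr_sq
  simp only [F5, F5op, EI, L5, pval]
  push_cast
  linear_combination (30 * Wr * ((1 - 4 * X) + Wr ^ 2) - 20 * Wr ^ 3) * h

theorem F7_eq : F7 = pval L7 + ((32 : ℤ) : ℚ⟦X⟧) * Wr ^ 7 := by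
  have h := Wr_sq
  have h3 := F3_eq
  have h5 := F5_eq
  rw [F7, F7op, ← F3, ← F5, h3, h5]
  simp only [EI, L3, L5, L7, pval]
  push_cast
  linear_combination (-70 * Wr * ((1 - 4 * X) ^ 2 + (1 - 4 * X) * Wr ^ 2 + Wr ^ 4)
    + 140 * Wr ^ 3 * ((1 - 4 * X) + Wr ^ 2) - 112 * Wr ^ 5) * h

noncomputable def cc (n : ℕ) : ℚ := (catalan n : ℚ)

theorem cc_pos (n : ℕ) : 0 < cc n := by
  have h := succ_mul_catalan_eq_centralBinom n
  have h2 := Nat.centralBinom_pos n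
  rw [← h] at h2
  unfold cc
  exact_mod_cast Nat.pos_of_mul_pos_left h2

theorem cc_succ (n : ℕ) : ((n : ℚ) + 2) * cc (n + 1) = (4 * n + 2) * cc n := by
  have h := succ_mul_catalan_eq_centralBinom n
  have h1 := succ_mul_catalan_eq_centralBinom (n + 1)
  have h2 := Nat.succ_mul_centralBinom_succ n
  rw [← h, ← h1] at h2
  have h3 : ((n : ℚ) + 1) * ((n + 1 + 1) * cc (n + 1)) = 2 * (2 * n + 1) * ((n + 1) * cc n) := by
    unfold cc; exact_mod_cast h2
  have hn : (n : ℚ) + 1 ≠ 0 := by positivity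
  apply mul_left_cancel₀ hn
  linear_combination h3

theorem Wr_coeff_zero : coeff 0 Wr = 1 := by
  unfold Wr; rw [mul_comm 2 X, mul_assoc]; simp

theorem Wr_coeff_succ (n : ℕ) : coeff (n + 1) Wr = -2 * cc n := by
  have : Wr = ((1 : ℤ) : ℚ⟦X⟧) + X * (((-2 : ℤ) : ℚ⟦X⟧) * Cat) := by
    unfold Wr; push_cast; ring
  rw [this, map_add, coeff_intCast_succ, PowerSeries.coeff_succ_X_mul, coeff_int_mul]
  simp [Cat, cc]

theorem shift_zero (f : ℚ⟦X⟧) : coeff 0 ((1 - 4 * X) * f) = coeff 0 f := by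
  rw [show (1 - 4 * X) * f = f - X * (4 * f) by ring]; simp

theorem shift_succ (f : ℚ⟦X⟧) (n : ℕ) :
    coeff (n + 1) ((1 - 4 * X) * f) = coeff (n + 1) f - 4 * coeff n f := by
  rw [show (1 - 4 * X) * f = f - X * (((4 : ℕ) : ℚ⟦X⟧) * f) by push_cast; ring, map_sub,
    PowerSeries.coeff_succ_X_mul, coeff_nat_mul]
  norm_num

theorem W3_eq : Wr ^ 3 = (1 - 4 * X) * Wr := by rw [← Wr_sq]; ring
theorem W5_eq : Wr ^ 5 = (1 - 4 * X) * Wr ^ 3 := by rw [← Wr_sq]; ring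
theorem W7_eq : Wr ^ 7 = (1 - 4 * X) * Wr ^ 5 := by rw [← Wr_sq]; ring

theorem shift_rec (f : ℚ⟦X⟧) (i : ℚ)
    (h : ∀ n : ℕ, ((n : ℚ) + 1) * coeff (n + 1) f = (4 * n - 2 * i) * coeff n f) (n : ℕ) :
    ((n : ℚ) + 1) * coeff (n + 1) ((1 - 4 * X) * f) =
      (4 * n - 2 * (i + 2)) * coeff n ((1 - 4 * X) * f) := by
  rw [shift_succ]
  cases n with
  | zero =>
    rw [shift_zero]
    have := h 0
    push_cast at *
    linear_combination this
  | succ n =>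
    rw [shift_succ]
    have h1 := h (n + 1)
    have h2 := h n
    push_cast at *
    linear_combination h1 - 4 * h2

theorem W1_rec (n : ℕ) : ((n : ℚ) + 1) * coeff (n + 1) Wr = (4 * n - 2 * 1) * coeff n Wr := by
  rw [Wr_coeff_succ]
  cases n with
  | zero => rw [Wr_coeff_zero]; simp [cc]
  | succ n =>
    rw [Wr_coeff_succ]
    have := cc_succ n
    push_cast
    linear_combination (-2) * this

theorem W3_rec (n : ℕ) : ((n : ℚ) + 1) * coeff (n + 1) (Wr ^ 3) = (4 * n - 6) * coeff n (Wr ^ 3) := by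
  have := shift_rec Wr 1 W1_rec n
  rw [← W3_eq] at this
  linear_combination this

theorem W5_rec (n : ℕ) : ((n : ℚ) + 1) * coeff (n + 1) (Wr ^ 5) =
    (4 * n - 10) * coeff n (Wr ^ 5) := by
  have := shift_rec (Wr ^ 3) 3 (fun n => by rw [W3_rec]; ring) n
  rw [← W5_eq] at this
  linear_combination this

theorem W7_rec (n : ℕ) : ((n : ℚ) + 1) * coeff (n + 1) (Wr ^ 7) =
    (4 * n - 14) * coeff n (Wr ^ 7) := by
  have := shift_rec (Wr ^ 5) 5 (fun n => by rw [W5_rec]; ring) n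
  rw [← W7_eq] at this
  linear_combination this

theorem W3_zero : coeff 0 (Wr ^ 3) = 1 := by rw [W3_eq, shift_zero, Wr_coeff_zero]
theorem W5_zero : coeff 0 (Wr ^ 5) = 1 := by rw [W5_eq, shift_zero, W3_zero]
theorem W7_zero : coeff 0 (Wr ^ 7) = 1 := by rw [W7_eq, shift_zero, W5_zero]

theorem W3_closed (n : ℕ) : (2 * (n : ℚ) - 1) * (2 * n - 3) * coeff n (Wr ^ 3) =
    3 * (n + 1) * cc n := by
  induction n with
  | zero => rw [W3_zero]; simp [cc]
  | succ n ih =>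
    have hn : (n : ℚ) + 1 ≠ 0 := by positivity
    apply mul_left_cancel₀ hn
    have h := W3_rec n
    have hc := cc_succ n
    push_cast
    linear_combination (2 * (n : ℚ) + 1) * (2 * n - 1) * h + 2 * (2 * (n : ℚ) + 1) * ih
      - 3 * (n + 1) * hc

theorem W5_closed (n : ℕ) : (2 * (n : ℚ) - 1) * (2 * n - 3) * (2 * n - 5) * coeff n (Wr ^ 5) =
    -15 * (n + 1) * cc n := by
  induction n with
  | zero => rw [W5_zero]; simp [cc]; norm_num
  | succ n ih =>
    have hn : (n : ℚ) + 1 ≠ 0 := by positivity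
    apply mul_left_cancel₀ hn
    have h := W5_rec n
    have hc := cc_succ n
    push_cast
    linear_combination (2 * (n : ℚ) + 1) * (2 * n - 1) * (2 * n - 3) * h +
      2 * (2 * (n : ℚ) + 1) * ih + 15 * (n + 1) * hc

theorem W7_closed (n : ℕ) : (2 * (n : ℚ) - 1) * (2 * n - 3) * (2 * n - 5) * (2 * n - 7) *
    coeff n (Wr ^ 7) = 105 * (n + 1) * cc n := by
  induction n with
  | zero => rw [W7_zero]; simp [cc]; norm_num
  | succ n ih =>
    have hn : (n : ℚ) + 1 ≠ 0 := by positivity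
    apply mul_left_cancel₀ hn
    have h := W7_rec n
    have hc := cc_succ n
    push_cast
    linear_combination (2 * (n : ℚ) + 1) * (2 * n - 1) * (2 * n - 3) * (2 * n - 5) * h +
      2 * (2 * (n : ℚ) + 1) * ih - 105 * (n + 1) * hc

/-! the auxiliary series -/

noncomputable def sG : ℚ⟦X⟧ := iv * F3
noncomputable def sH1 : ℚ⟦X⟧ := i1 * F5
noncomputable def sH2 : ℚ⟦X⟧ := iv * F5
noncomputable def sH3 : ℚ⟦X⟧ := i3 * F5
noncomputable def sQ : ℚ⟦X⟧ := ik * F7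
noncomputable def sQp : ℚ⟦X⟧ := X * sQ
noncomputable def sK : ℚ⟦X⟧ := (1 - 2 * X) * sQ
noncomputable def sR1 : ℚ⟦X⟧ := i3 * sQ
noncomputable def sR2 : ℚ⟦X⟧ := i1 * sR1
noncomputable def sR3 : ℚ⟦X⟧ := iv * sR2
noncomputable def sR4 : ℚ⟦X⟧ := iv * sQ

theorem UI_eq : UI = ((3360 : ℤ) : ℚ⟦X⟧) * EI 1 + ((-560 : ℤ) : ℚ⟦X⟧) * sG +
    (((189 : ℤ) : ℚ⟦X⟧) * sH3 + ((-112 : ℤ) : ℚ⟦X⟧) * sH2 + ((-7 : ℤ) : ℚ⟦X⟧) * sH1) := by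
  have h1 := i1_mul
  have h3 := i3_mul
  have hv := iv_mul
  have key : 2 * Cc = 27 * i3 - 16 * iv - i1 := by
    have hA : 2 * (i1 * i3) = 3 * i3 - i1 := by linear_combination 3 * i3 * h1 - i1 * h3
    have hB : iv * i1 = 2 * iv - i1 := by linear_combination 2 * iv * h1 - i1 * hv
    have hC : iv * i3 = 3 * i3 - 2 * iv := by linear_combination 3 * i3 * hv - 2 * iv * h3
    unfold Cc
    linear_combination 3 * hA + 2 * iv * hA + 6 * hC - 2 * hB
  unfold UI Uop sG sH1 sH2 sH3
  rw [← F3, ← F5]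
  push_cast
  linear_combination 7 * F5 * key

theorem ErI_eq : ErI = ((9 : ℤ) : ℚ⟦X⟧) * sR2 + ((6 : ℤ) : ℚ⟦X⟧) * sR3 +
    ((6 : ℤ) : ℚ⟦X⟧) * sR4 := by
  unfold ErI Eop sR4 sR3 sR2 sR1 sQ Cc
  rw [← F7]
  push_cast
  ring

theorem rec_zero (k : ℕ) {a f : ℚ⟦X⟧} (h : (1 - (k : ℚ⟦X⟧) * X) * a = f) :
    coeff 0 a = coeff 0 f := by
  rw [← h, show (1 - (k : ℚ⟦X⟧) * X) * a = a - X * ((k : ℚ⟦X⟧) * a) by ring]; simp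

theorem rec_succ (k : ℕ) {a f : ℚ⟦X⟧} (h : (1 - (k : ℚ⟦X⟧) * X) * a = f) (n : ℕ) :
    coeff (n + 1) a = k * coeff n a + coeff (n + 1) f := by
  rw [← h, show (1 - (k : ℚ⟦X⟧) * X) * a = a - X * ((k : ℚ⟦X⟧) * a) by ring, map_sub,
    PowerSeries.coeff_succ_X_mul, coeff_nat_mul]
  ring

theorem rG : (1 - ((2 : ℕ) : ℚ⟦X⟧) * X) * sG = F3 := by
  unfold sG; push_cast; linear_combination F3 * iv_mul
theorem rH1 : (1 - ((1 : ℕ) : ℚ⟦X⟧) * X) * sH1 = F5 := by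
  unfold sH1; push_cast; linear_combination F5 * i1_mul
theorem rH2 : (1 - ((2 : ℕ) : ℚ⟦X⟧) * X) * sH2 = F5 := by
  unfold sH2; push_cast; linear_combination F5 * iv_mul
theorem rH3 : (1 - ((3 : ℕ) : ℚ⟦X⟧) * X) * sH3 = F5 := by
  unfold sH3; push_cast; linear_combination F5 * i3_mul
theorem rQ : (1 - ((2 : ℕ) : ℚ⟦X⟧) * X) * sQ = sK := by
  unfold sK; push_cast; ring
theorem rK : (1 - ((2 : ℕ) : ℚ⟦X⟧) * X) * sK = F7 + X * (((2 : ℕ) : ℚ⟦X⟧) * sQp) := by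
  unfold sK sQp sQ; push_cast; linear_combination F7 * ik_mul
theorem rR1 : (1 - ((3 : ℕ) : ℚ⟦X⟧) * X) * sR1 = sQ := by
  unfold sR1; push_cast; linear_combination sQ * i3_mul
theorem rR2 : (1 - ((1 : ℕ) : ℚ⟦X⟧) * X) * sR2 = sR1 := by
  unfold sR2; push_cast; linear_combination sR1 * i1_mul
theorem rR3 : (1 - ((2 : ℕ) : ℚ⟦X⟧) * X) * sR3 = sR2 := by
  unfold sR3; push_cast; linear_combination sR2 * iv_mul
theorem rR4 : (1 - ((2 : ℕ) : ℚ⟦X⟧) * X) * sR4 = sQ := by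
  unfold sR4; push_cast; linear_combination sQ * iv_mul

theorem sQp_succ (n : ℕ) : coeff (n + 1) sQp = coeff n sQ := by
  unfold sQp; rw [PowerSeries.coeff_succ_X_mul]

theorem sK_succ (n : ℕ) : coeff (n + 1) sK = 2 * coeff n sK + (coeff (n + 1) F7 +
    2 * coeff n sQp) := by
  rw [rec_succ 2 rK, map_add, PowerSeries.coeff_succ_X_mul, coeff_nat_mul]
  norm_num

theorem F3_coeff (n : ℕ) : coeff n F3 = (L3.getD n 0 : ℤ) + 4 * coeff n (Wr ^ 3) := by
  rw [F3_eq, map_add, coeff_int_mul, coeff_pval]; norm_num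
theorem F5_coeff (n : ℕ) : coeff n F5 = (L5.getD n 0 : ℤ) + (-16) * coeff n (Wr ^ 5) := by
  rw [F5_eq, map_add, coeff_int_mul, coeff_pval]; norm_num
theorem F7_coeff (n : ℕ) : coeff n F7 = (L7.getD n 0 : ℤ) + 32 * coeff n (Wr ^ 7) := by
  rw [F7_eq, map_add, coeff_int_mul, coeff_pval]; norm_num

theorem EI_coeff (n : ℕ) : coeff (n + 2) (EI 1) = -2 * coeff (n + 2) Wr := by
  have : EI 1 = pval [2, -2] + ((-2 : ℤ) : ℚ⟦X⟧) * Wr := by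
    simp only [EI, pval]; push_cast; ring
  rw [this, map_add, coeff_int_mul, coeff_pval]
  simp

theorem UI_coeff (n : ℕ) : coeff (n + 2) UI = 3360 * (-2 * coeff (n + 2) Wr)
    - 560 * coeff (n + 2) sG + 189 * coeff (n + 2) sH3 - 112 * coeff (n + 2) sH2
    - 7 * coeff (n + 2) sH1 := by
  rw [UI_eq]
  simp only [map_add, coeff_int_mul, EI_coeff]
  push_cast
  ring

theorem ErI_coeff (n : ℕ) : coeff n ErI = 9 * coeff n sR2 + 6 * coeff n sR3 + 6 * coeff n sR4 := by
  rw [ErI_eq]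
  simp only [map_add, coeff_int_mul]
  push_cast
  ring

end LISProof

namespace LISProof

open Finset PowerSeries

/-! verified computation along the recurrences -/

def forceZ {α : Type} (x : ℤ) (k : ℤ → α) : α :=
  match x with
  | Int.ofNat m => force m fun m => k (Int.ofNat m)
  | Int.negSucc m => force m fun m => k (Int.negSucc m)

theorem forceZ_eq {α : Type} (x : ℤ) (k : ℤ → α) : forceZ x k = k x := by
  cases x <;> simp [forceZ, force_eq]

structure St where
  c : ℤ
  w1 : ℤ
  w3 : ℤ
  w5 : ℤ
  w7 : ℤ
  G : ℤ
  H1 : ℤ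
  H2 : ℤ
  H3 : ℤ
  K : ℤ
  Qp : ℤ
  Q : ℤ
  R1 : ℤ
  R2 : ℤ
  R3 : ℤ
  R4 : ℤ

structure Mt (n : ℕ) (s : St) : Prop where
  c : cc n = (s.c : ℚ)
  w1 : coeff n Wr = (s.w1 : ℚ)
  w3 : coeff n (Wr ^ 3) = (s.w3 : ℚ)
  w5 : coeff n (Wr ^ 5) = (s.w5 : ℚ)
  w7 : coeff n (Wr ^ 7) = (s.w7 : ℚ)
  G : coeff n sG = (s.G : ℚ)
  H1 : coeff n sH1 = (s.H1 : ℚ)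
  H2 : coeff n sH2 = (s.H2 : ℚ)
  H3 : coeff n sH3 = (s.H3 : ℚ)
  K : coeff n sK = (s.K : ℚ)
  Qp : coeff n sQp = (s.Qp : ℚ)
  Q : coeff n sQ = (s.Q : ℚ)
  R1 : coeff n sR1 = (s.R1 : ℚ)
  R2 : coeff n sR2 = (s.R2 : ℚ)
  R3 : coeff n sR3 = (s.R3 : ℚ)
  R4 : coeff n sR4 = (s.R4 : ℚ)

/-- one step, evaluated and handed to the continuation together with the exactness check -/
def stepK (n : ℕ) (s : St) (k : St → Bool) : Bool :=
  forceZ ((4 * (n : ℤ) + 2) * s.c / ((n : ℤ) + 2)) fun c =>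
  forceZ (-2 * s.c) fun w1 =>
  forceZ (w1 - 4 * s.w1) fun w3 =>
  forceZ (w3 - 4 * s.w3) fun w5 =>
  forceZ (w5 - 4 * s.w5) fun w7 =>
  forceZ (L5.getD (n + 1) 0 + (-16) * w5) fun f5 =>
  forceZ (2 * s.G + (L3.getD (n + 1) 0 + 4 * w3)) fun G =>
  forceZ (s.H1 + f5) fun H1 =>
  forceZ (2 * s.H2 + f5) fun H2 =>
  forceZ (3 * s.H3 + f5) fun H3 =>
  forceZ (2 * s.K + ((L7.getD (n + 1) 0 + 32 * w7) + 2 * s.Qp)) fun K =>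
  forceZ (2 * s.Q + K) fun Q =>
  forceZ (3 * s.R1 + Q) fun R1 =>
  forceZ (s.R2 + R1) fun R2 =>
  forceZ (2 * s.R3 + R2) fun R3 =>
  forceZ (2 * s.R4 + Q) fun R4 =>
  decide (((n : ℤ) + 2) * c = (4 * (n : ℤ) + 2) * s.c) &&
    k ⟨c, w1, w3, w5, w7, G, H1, H2, H3, K, s.Q, Q, R1, R2, R3, R4⟩

theorem stepK_sound {n : ℕ} {s : St} {k : St → Bool} (hs : Mt n s) (h : stepK n s k = true) :
    ∃ s', Mt (n + 1) s' ∧ k s' = true := by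
  unfold stepK at h
  simp only [forceZ_eq, Bool.and_eq_true, decide_eq_true_eq] at h
  refine ⟨_, ?_, h.2⟩
  have hc : ((n : ℚ) + 2) * (((4 * (n : ℤ) + 2) * s.c / ((n : ℤ) + 2) : ℤ) : ℚ) =
      (4 * n + 2) * s.c := by exact_mod_cast h.1
  have hw1 : coeff (n + 1) Wr = ((-2 * s.c : ℤ) : ℚ) := by
    rw [Wr_coeff_succ, hs.c]; push_cast; ring
  have hw3 : coeff (n + 1) (Wr ^ 3) = ((-2 * s.c - 4 * s.w1 : ℤ) : ℚ) := by
    rw [W3_eq, shift_succ, hw1, hs.w1]; push_cast; ring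
  have hw5 : coeff (n + 1) (Wr ^ 5) = ((-2 * s.c - 4 * s.w1 - 4 * s.w3 : ℤ) : ℚ) := by
    rw [W5_eq, shift_succ, hw3, hs.w3]; push_cast; ring
  have hw7 : coeff (n + 1) (Wr ^ 7) = ((-2 * s.c - 4 * s.w1 - 4 * s.w3 - 4 * s.w5 : ℤ) : ℚ) := by
    rw [W7_eq, shift_succ, hw5, hs.w5]; push_cast; ring
  have hK := sK_succ n
  rw [F7_coeff, hw7, hs.Qp, hs.K] at hK
  have hQ := rec_succ 2 rQ n
  rw [hK, hs.Q] at hQ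
  have hR1 := rec_succ 3 rR1 n
  rw [hQ, hs.R1] at hR1
  have hR2 := rec_succ 1 rR2 n
  rw [hR1, hs.R2] at hR2
  have hR3 := rec_succ 2 rR3 n
  rw [hR2, hs.R3] at hR3
  have hR4 := rec_succ 2 rR4 n
  rw [hQ, hs.R4] at hR4
  constructor
  · have h0 : (n : ℚ) + 2 ≠ 0 := by positivity
    apply mul_left_cancel₀ h0
    rw [hc, cc_succ, hs.c]
  · exact hw1
  · exact hw3
  · exact hw5
  · exact hw7
  · rw [rec_succ 2 rG, F3_coeff, hw3, hs.G]; push_cast; ring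
  · rw [rec_succ 1 rH1, F5_coeff, hw5, hs.H1]; push_cast; ring
  · rw [rec_succ 2 rH2, F5_coeff, hw5, hs.H2]; push_cast; ring
  · rw [rec_succ 3 rH3, F5_coeff, hw5, hs.H3]; push_cast; ring
  · rw [hK]; push_cast; ring
  · rw [sQp_succ, hs.Q]
  · rw [hQ]; push_cast; ring
  · rw [hR1]; push_cast; ring
  · rw [hR2]; push_cast; ring
  · rw [hR3]; push_cast; ring
  · rw [hR4]; push_cast; ring

def St.U (s : St) : ℤ :=
  3360 * (-2 * s.w1) - 560 * s.G + 189 * s.H3 - 112 * s.H2 - 7 * s.H1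

def St.E (s : St) : ℤ := 9 * s.R2 + 6 * s.R3 + 6 * s.R4

theorem Mt.U {n : ℕ} {s : St} (h : Mt (n + 2) s) : coeff (n + 2) UI = (s.U : ℚ) := by
  rw [UI_coeff, h.w1, h.G, h.H3, h.H2, h.H1, St.U]; push_cast; ring

theorem Mt.E {n : ℕ} {s : St} (h : Mt n s) : coeff n ErI = (s.E : ℚ) := by
  rw [ErI_coeff, h.R2, h.R3, h.R4, St.E]; push_cast; ring

/-- run `fuel` steps without any check, then continue -/
def run1 : ℕ → ℕ → St → (ℕ → St → Bool) → Bool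
  | 0, n, s, k => k n s
  | fuel + 1, n, s, k => stepK n s fun s' => run1 fuel (n + 1) s' k

theorem run1_sound (fuel : ℕ) {n : ℕ} {s : St} {k : ℕ → St → Bool} (hs : Mt n s)
    (h : run1 fuel n s k = true) : ∃ s', Mt (n + fuel) s' ∧ k (n + fuel) s' = true := by
  induction fuel generalizing n s with
  | zero => exact ⟨s, hs, h⟩
  | succ fuel ih =>
    obtain ⟨s', h1, h2⟩ := stepK_sound hs h
    obtain ⟨s'', h3, h4⟩ := ih h1 h2
    rw [show n + 1 + fuel = n + (fuel + 1) by omega] at h3 h4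
    exact ⟨s'', h3, h4⟩

/-- run `fuel` steps checking the inequality each time, then continue -/
def run2 : ℕ → ℕ → St → (St → Bool) → Bool
  | 0, _, s, k => k s
  | fuel + 1, n, s, k => stepK n s fun s' =>
    decide (((n : ℤ) + 2) * s'.U < (4 * (n : ℤ) + 2) * (s.U - s.E)) && run2 fuel (n + 1) s' k

theorem run2_sound (fuel : ℕ) {n : ℕ} {s : St} {k : St → Bool} (hs : Mt (n + 2) s)
    (h : run2 fuel (n + 2) s k = true) : (∃ s', Mt (n + 2 + fuel) s' ∧ k s' = true) ∧
    ∀ m : ℕ, n ≤ m → m < n + fuel → ((m : ℚ) + 4) * coeff (m + 3) UI <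
      (4 * m + 10) * (coeff (m + 2) UI - coeff (m + 2) ErI) := by
  induction fuel generalizing n s with
  | zero => exact ⟨⟨s, hs, h⟩, fun m _ _ => by omega⟩
  | succ fuel ih =>
    obtain ⟨s', h1, h2⟩ := stepK_sound hs h
    rw [Bool.and_eq_true, decide_eq_true_eq] at h2
    have h1' : Mt (n + 1 + 2) s' := h1
    obtain ⟨⟨s'', h3, h4⟩, h5⟩ := ih h1' h2.2
    rw [show n + 1 + 2 + fuel = n + 2 + (fuel + 1) by omega] at h3
    refine ⟨⟨s'', h3, h4⟩, fun m hm hm2 => ?_⟩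
    rcases Nat.eq_or_lt_of_le hm with rfl | hlt
    · have e1 := hs.U
      have e2 := hs.E
      have e3 : coeff (n + 3) UI = (s'.U : ℚ) := h1'.U
      rw [e1, e2, e3]
      have := h2.1
      have h6 : (((n + 2 : ℕ) : ℤ) + 2 : ℚ) * s'.U < (4 * ((n + 2 : ℕ) : ℤ) + 2) * (s.U - s.E) := by
        exact_mod_cast this
      push_cast at h6
      linarith
    · exact h5 m hlt (by omega)

def fin (s : St) : Bool :=
  decide (30329 * s.c ≤ 2500000 * s.G) && decide (2500000 * s.G ≤ 30336 * s.c) &&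
  decide (125000000 * s.H1 ≤ 20300 * s.c) && decide (20240 * s.c ≤ 125000000 * s.H1) &&
  decide (125000000 * s.H2 ≤ 30585 * s.c) && decide (30510 * s.c ≤ 125000000 * s.H2) &&
  decide (125000000 * s.H3 ≤ 62100 * s.c) && decide (61800 * s.c ≤ 125000000 * s.H3) &&
  decide (125000000 * s.K ≤ 975 * s.c) && decide (125000000 * s.Q ≤ 2025 * s.c) &&
  decide (124251499 * 1998 * s.Qp ≤ 2025 * 501 * s.c) &&
  decide (125000000 * s.R1 ≤ 8500 * s.c) && decide (125000000 * s.R2 ≤ 11500 * s.c) &&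
  decide (125000000 * s.R3 ≤ 23500 * s.c) && decide (125000000 * s.R4 ≤ 4150 * s.c)

def s0 : St := ⟨1, 1, 1, 1, 1, 0, 0, 0, 0, 0, 0, 0, 0, 0, 0, 0⟩

theorem Mt_zero : Mt 0 s0 := by
  have f3 : coeff 0 F3 = 0 := by rw [F3_coeff, W3_zero]; simp [L3]
  have f5 : coeff 0 F5 = 0 := by rw [F5_coeff, W5_zero]; simp [L5]
  have f7 : coeff 0 F7 = 0 := by rw [F7_coeff, W7_zero]; simp [L7]
  have qp : coeff 0 sQp = 0 := by simp [sQp]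
  have k : coeff 0 sK = 0 := by rw [rec_zero 2 rK, map_add, f7]; simp
  have q : coeff 0 sQ = 0 := by rw [rec_zero 2 rQ, k]
  have r1 : coeff 0 sR1 = 0 := by rw [rec_zero 3 rR1, q]
  have r2 : coeff 0 sR2 = 0 := by rw [rec_zero 1 rR2, r1]
  constructor <;> simp only [s0, Int.cast_zero, Int.cast_one]
  · simp [cc]
  · exact Wr_coeff_zero
  · exact W3_zero
  · exact W5_zero
  · exact W7_zero
  · rw [rec_zero 2 rG, f3]
  · rw [rec_zero 1 rH1, f5]
  · rw [rec_zero 2 rH2, f5]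
  · rw [rec_zero 3 rH3, f5]
  · exact k
  · exact qp
  · exact q
  · exact r1
  · exact r2
  · rw [rec_zero 2 rR3, r2]
  · rw [rec_zero 2 rR4, q]

theorem run_ok : run1 182 0 s0 (fun n s => run2 318 n s fin) = true := by decide +kernel

theorem run_all : (∃ s, Mt 500 s ∧ fin s = true) ∧
    ∀ m : ℕ, 180 ≤ m → m < 498 → ((m : ℚ) + 4) * coeff (m + 3) UI <
      (4 * m + 10) * (coeff (m + 2) UI - coeff (m + 2) ErI) := by
  obtain ⟨s, hs, h⟩ := run1_sound 182 Mt_zero run_ok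
  exact run2_sound 318 (n := 180) hs h

end LISProof

namespace LISProof

open Finset PowerSeries

/-! asymptotic bounds -/

theorem getD_zero (l : List ℤ) (n : ℕ) (h : l.length ≤ n) : l.getD n 0 = 0 := by
  simp [List.getD, List.getElem?_eq_none h]

theorem f3_val (t : ℕ) : coeff (500 + t + 1) F3 =
    12 * ((t : ℚ) + 502) / ((2 * t + 1001) * (2 * t + 999)) * cc (500 + t + 1) := by
  rw [F3_coeff, getD_zero L3 _ (by simp [L3]; omega)]
  have h := W3_closed (500 + t + 1)
  push_cast at h ⊢
  rw [div_mul_eq_mul_div, eq_div_iff (by positivity)]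
  linear_combination 4 * h

theorem f5_val (t : ℕ) : coeff (500 + t + 1) F5 =
    240 * ((t : ℚ) + 502) / ((2 * t + 1001) * (2 * t + 999) * (2 * t + 997)) *
      cc (500 + t + 1) := by
  rw [F5_coeff, getD_zero L5 _ (by simp [L5]; omega)]
  have h := W5_closed (500 + t + 1)
  push_cast at h ⊢
  rw [div_mul_eq_mul_div, eq_div_iff (by positivity)]
  linear_combination (-16) * h

theorem f7_val (t : ℕ) : coeff (500 + t + 1) F7 =
    3360 * ((t : ℚ) + 502) / ((2 * t + 1001) * (2 * t + 999) * (2 * t + 997) * (2 * t + 995)) *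
      cc (500 + t + 1) := by
  rw [F7_coeff, getD_zero L7 _ (by simp [L7]; omega)]
  have h := W7_closed (500 + t + 1)
  push_cast at h ⊢
  rw [div_mul_eq_mul_div, eq_div_iff (by positivity)]
  linear_combination 32 * h

theorem cc_prev (t : ℕ) : cc (500 + t) =
    ((t : ℚ) + 502) / (4 * t + 2002) * cc (500 + t + 1) := by
  have h := cc_succ (500 + t)
  push_cast at h
  rw [div_mul_eq_mul_div, eq_div_iff (by positivity)]
  linear_combination -h

theorem step_up (a f : ℕ → ℚ) (k : ℚ) (hk : 0 ≤ k) (b r : ℚ → ℚ)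
    (h0 : a 500 ≤ b 0 * cc 500)
    (hrec : ∀ t : ℕ, a (500 + t + 1) = k * a (500 + t) + f (500 + t + 1))
    (hf : ∀ t : ℕ, f (500 + t + 1) ≤ r t * cc (500 + t + 1))
    (hb : ∀ x : ℚ, 0 ≤ x → k * (b x * ((x + 502) / (4 * x + 2002))) + r x ≤ b (x + 1))
    (t : ℕ) : a (500 + t) ≤ b t * cc (500 + t) := by
  induction t with
  | zero => simpa using h0
  | succ t ih =>
    have e : 500 + (t + 1) = 500 + t + 1 := by omega
    rw [e, hrec]
    have h1 := mul_le_mul_of_nonneg_left ih hk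
    rw [cc_prev] at h1
    have h2 := mul_le_mul_of_nonneg_right (hb t (by positivity)) (cc_pos (500 + t + 1)).le
    have h3 := hf t
    push_cast
    linarith

theorem step_lo (a f : ℕ → ℚ) (k : ℚ) (hk : 0 ≤ k) (b r : ℚ → ℚ)
    (h0 : b 0 * cc 500 ≤ a 500)
    (hrec : ∀ t : ℕ, a (500 + t + 1) = k * a (500 + t) + f (500 + t + 1))
    (hf : ∀ t : ℕ, r t * cc (500 + t + 1) ≤ f (500 + t + 1))
    (hb : ∀ x : ℚ, 0 ≤ x → b (x + 1) ≤ k * (b x * ((x + 502) / (4 * x + 2002))) + r x)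
    (t : ℕ) : b t * cc (500 + t) ≤ a (500 + t) := by
  have := step_up (fun n => - a n) (fun n => - f n) k hk (fun x => - b x) (fun x => - r x)
    (by simpa using h0) (fun t => by simp only [hrec]; ring) (fun t => by have := hf t; linarith)
    (fun x hx => by have := hb x hx; linarith) t
  linarith

theorem start500 :
    (6 * 500 + 32.9) / 500 ^ 2 * cc 500 ≤ coeff 500 sG ∧
    coeff 500 sG ≤ (6 * 500 + 33.6) / 500 ^ 2 * cc 500 ∧
    20240 / 500 ^ 3 * cc 500 ≤ coeff 500 sH1 ∧ coeff 500 sH1 ≤ 20300 / 500 ^ 3 * cc 500 ∧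
    30510 / 500 ^ 3 * cc 500 ≤ coeff 500 sH2 ∧ coeff 500 sH2 ≤ 30585 / 500 ^ 3 * cc 500 ∧
    61800 / 500 ^ 3 * cc 500 ≤ coeff 500 sH3 ∧ coeff 500 sH3 ≤ 62100 / 500 ^ 3 * cc 500 ∧
    coeff 500 sK ≤ 975 / 500 ^ 3 * cc 500 ∧ coeff 500 sQ ≤ 2025 / 500 ^ 3 * cc 500 ∧
    coeff 500 sQp ≤ 2025 * 501 / (499 ^ 3 * 1998) * cc 500 ∧
    coeff 500 sR1 ≤ 8500 / 500 ^ 3 * cc 500 ∧ coeff 500 sR2 ≤ 11500 / 500 ^ 3 * cc 500 ∧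
    coeff 500 sR3 ≤ 23500 / 500 ^ 3 * cc 500 ∧ coeff 500 sR4 ≤ 4150 / 500 ^ 3 * cc 500 := by
  obtain ⟨⟨s, hs, h⟩, -⟩ := run_all
  unfold fin at h
  simp only [Bool.and_eq_true, decide_eq_true_eq] at h
  obtain ⟨⟨⟨⟨⟨⟨⟨⟨⟨⟨⟨⟨⟨⟨h1, h2⟩, h3⟩, h4⟩, h5⟩, h6⟩, h7⟩, h8⟩, h9⟩, h10⟩, h11⟩, h12⟩, h13⟩, h14⟩, h15⟩ := h
  qify at h1 h2 h3 h4 h5 h6 h7 h8 h9 h10 h11 h12 h13 h14 h15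
  rw [hs.c, hs.G, hs.H1, hs.H2, hs.H3, hs.K, hs.Q, hs.Qp, hs.R1, hs.R2, hs.R3, hs.R4]
  clear hs
  norm_num only at h11
  refine ⟨?_, ?_, ?_, ?_, ?_, ?_, ?_, ?_, ?_, ?_, ?_, ?_, ?_, ?_, ?_⟩ <;> norm_num only <;> linarith

theorem G_lo (t : ℕ) : (6 * (t : ℚ) + 3032.9) / ((t : ℚ) + 500) ^ 2 * cc (500 + t) ≤ coeff (500 + t) sG := by
  refine step_lo (fun n => coeff n sG) (fun n => coeff n F3) 2 (by norm_num)
    (fun x => (6 * x + 3032.9) / (x + 500) ^ 2)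
    (fun x => 12 * (x + 502) / ((2 * x + 1001) * (2 * x + 999))) ?_
    (fun t => by simpa using rec_succ 2 rG (500 + t)) (fun t => by simp only [f3_val]; exact le_refl _) ?_ t
  · have := start500
    norm_num only at this ⊢
    tauto
  · intro x hx
    rw [div_mul_div_comm, ← mul_div_assoc, div_add_div _ _ (by positivity) (by positivity),
      div_le_div_iff₀ (by positivity) (by positivity), ← sub_nonneg]
    ring_nf
    positivity

theorem G_up (t : ℕ) : coeff (500 + t) sG ≤ (6 * (t : ℚ) + 3033.6) / ((t : ℚ) + 500) ^ 2 * cc (500 + t) := by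
  refine step_up (fun n => coeff n sG) (fun n => coeff n F3) 2 (by norm_num)
    (fun x => (6 * x + 3033.6) / (x + 500) ^ 2)
    (fun x => 12 * (x + 502) / ((2 * x + 1001) * (2 * x + 999))) ?_
    (fun t => by simpa using rec_succ 2 rG (500 + t)) (fun t => by simp only [f3_val]; exact le_refl _) ?_ t
  · have := start500
    norm_num only at this ⊢
    tauto
  · intro x hx
    rw [div_mul_div_comm, ← mul_div_assoc, div_add_div _ _ (by positivity) (by positivity),
      div_le_div_iff₀ (by positivity) (by positivity), ← sub_nonneg]
    ring_nf
    positivity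

theorem H1_lo (t : ℕ) : (40 * (t : ℚ) + 20240) / ((t : ℚ) + 500) ^ 3 * cc (500 + t) ≤ coeff (500 + t) sH1 := by
  refine step_lo (fun n => coeff n sH1) (fun n => coeff n F5) 1 (by norm_num)
    (fun x => (40 * x + 20240) / (x + 500) ^ 3)
    (fun x => 240 * (x + 502) / ((2 * x + 1001) * (2 * x + 999) * (2 * x + 997))) ?_
    (fun t => by simpa using rec_succ 1 rH1 (500 + t)) (fun t => by simp only [f5_val]; exact le_refl _) ?_ t
  · have := start500
    norm_num only at this ⊢
    tauto
  · intro x hx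
    rw [div_mul_div_comm, ← mul_div_assoc, div_add_div _ _ (by positivity) (by positivity),
      div_le_div_iff₀ (by positivity) (by positivity), ← sub_nonneg]
    ring_nf
    positivity

theorem H1_up (t : ℕ) : coeff (500 + t) sH1 ≤ (40 * (t : ℚ) + 20300) / ((t : ℚ) + 500) ^ 3 * cc (500 + t) := by
  refine step_up (fun n => coeff n sH1) (fun n => coeff n F5) 1 (by norm_num)
    (fun x => (40 * x + 20300) / (x + 500) ^ 3)
    (fun x => 240 * (x + 502) / ((2 * x + 1001) * (2 * x + 999) * (2 * x + 997))) ?_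
    (fun t => by simpa using rec_succ 1 rH1 (500 + t)) (fun t => by simp only [f5_val]; exact le_refl _) ?_ t
  · have := start500
    norm_num only at this ⊢
    tauto
  · intro x hx
    rw [div_mul_div_comm, ← mul_div_assoc, div_add_div _ _ (by positivity) (by positivity),
      div_le_div_iff₀ (by positivity) (by positivity), ← sub_nonneg]
    ring_nf
    positivity

theorem H2_lo (t : ℕ) : (60 * (t : ℚ) + 30510) / ((t : ℚ) + 500) ^ 3 * cc (500 + t) ≤ coeff (500 + t) sH2 := by
  refine step_lo (fun n => coeff n sH2) (fun n => coeff n F5) 2 (by norm_num)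
    (fun x => (60 * x + 30510) / (x + 500) ^ 3)
    (fun x => 240 * (x + 502) / ((2 * x + 1001) * (2 * x + 999) * (2 * x + 997))) ?_
    (fun t => by simpa using rec_succ 2 rH2 (500 + t)) (fun t => by simp only [f5_val]; exact le_refl _) ?_ t
  · have := start500
    norm_num only at this ⊢
    tauto
  · intro x hx
    rw [div_mul_div_comm, ← mul_div_assoc, div_add_div _ _ (by positivity) (by positivity),
      div_le_div_iff₀ (by positivity) (by positivity), ← sub_nonneg]
    ring_nf
    positivity

theorem H2_up (t : ℕ) : coeff (500 + t) sH2 ≤ (60 * (t : ℚ) + 30585) / ((t : ℚ) + 500) ^ 3 * cc (500 + t) := by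
  refine step_up (fun n => coeff n sH2) (fun n => coeff n F5) 2 (by norm_num)
    (fun x => (60 * x + 30585) / (x + 500) ^ 3)
    (fun x => 240 * (x + 502) / ((2 * x + 1001) * (2 * x + 999) * (2 * x + 997))) ?_
    (fun t => by simpa using rec_succ 2 rH2 (500 + t)) (fun t => by simp only [f5_val]; exact le_refl _) ?_ t
  · have := start500
    norm_num only at this ⊢
    tauto
  · intro x hx
    rw [div_mul_div_comm, ← mul_div_assoc, div_add_div _ _ (by positivity) (by positivity),
      div_le_div_iff₀ (by positivity) (by positivity), ← sub_nonneg]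
    ring_nf
    positivity

theorem H3_lo (t : ℕ) : (120 * (t : ℚ) + 61800) / ((t : ℚ) + 500) ^ 3 * cc (500 + t) ≤ coeff (500 + t) sH3 := by
  refine step_lo (fun n => coeff n sH3) (fun n => coeff n F5) 3 (by norm_num)
    (fun x => (120 * x + 61800) / (x + 500) ^ 3)
    (fun x => 240 * (x + 502) / ((2 * x + 1001) * (2 * x + 999) * (2 * x + 997))) ?_
    (fun t => by simpa using rec_succ 3 rH3 (500 + t)) (fun t => by simp only [f5_val]; exact le_refl _) ?_ t
  · have := start500
    norm_num only at this ⊢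
    tauto
  · intro x hx
    rw [div_mul_div_comm, ← mul_div_assoc, div_add_div _ _ (by positivity) (by positivity),
      div_le_div_iff₀ (by positivity) (by positivity), ← sub_nonneg]
    ring_nf
    positivity

theorem H3_up (t : ℕ) : coeff (500 + t) sH3 ≤ (120 * (t : ℚ) + 62100) / ((t : ℚ) + 500) ^ 3 * cc (500 + t) := by
  refine step_up (fun n => coeff n sH3) (fun n => coeff n F5) 3 (by norm_num)
    (fun x => (120 * x + 62100) / (x + 500) ^ 3)
    (fun x => 240 * (x + 502) / ((2 * x + 1001) * (2 * x + 999) * (2 * x + 997))) ?_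
    (fun t => by simpa using rec_succ 3 rH3 (500 + t)) (fun t => by simp only [f5_val]; exact le_refl _) ?_ t
  · have := start500
    norm_num only at this ⊢
    tauto
  · intro x hx
    rw [div_mul_div_comm, ← mul_div_assoc, div_add_div _ _ (by positivity) (by positivity),
      div_le_div_iff₀ (by positivity) (by positivity), ← sub_nonneg]
    ring_nf
    positivity

theorem KQ_up (t : ℕ) :
    coeff (500 + t) sK ≤ 975 / ((t : ℚ) + 500) ^ 3 * cc (500 + t) ∧
    coeff (500 + t) sQ ≤ 2025 / ((t : ℚ) + 500) ^ 3 * cc (500 + t) ∧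
    coeff (500 + t) sQp ≤ 2025 * ((t : ℚ) + 501) / (((t : ℚ) + 499) ^ 3 * (4 * t + 1998)) *
      cc (500 + t) := by
  induction t with
  | zero =>
    have := start500
    norm_num only [Nat.cast_zero, add_zero, zero_add, mul_zero] at this ⊢
    tauto
  | succ t ih =>
    obtain ⟨i1, i2, i3⟩ := ih
    have e : 500 + (t + 1) = 500 + t + 1 := by omega
    have p := (cc_pos (500 + t + 1)).le
    have hx : (0 : ℚ) ≤ t := by positivity
    rw [e]
    rw [cc_prev] at i1 i2 i3
    have hK : coeff (500 + t + 1) sK ≤ 975 / (((t + 1 : ℕ) : ℚ) + 500) ^ 3 * cc (500 + t + 1) := by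
      rw [sK_succ, f7_val]
      have key : 2 * (975 / ((t : ℚ) + 500) ^ 3 * (((t : ℚ) + 502) / (4 * t + 2002))) +
          (3360 * ((t : ℚ) + 502) / ((2 * t + 1001) * (2 * t + 999) * (2 * t + 997) * (2 * t + 995))
          + 2 * (2025 * ((t : ℚ) + 501) / (((t : ℚ) + 499) ^ 3 * (4 * t + 1998)) *
            (((t : ℚ) + 502) / (4 * t + 2002)))) ≤ 975 / (((t + 1 : ℕ) : ℚ) + 500) ^ 3 := by
        push_cast
        generalize (t : ℚ) = x at hx
        rw [div_mul_div_comm, div_mul_div_comm, ← mul_div_assoc, ← mul_div_assoc,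
          div_add_div _ _ (by positivity) (by positivity),
          div_add_div _ _ (by positivity) (by positivity),
          div_le_div_iff₀ (by positivity) (by positivity), ← sub_nonneg]
        ring_nf
        positivity
      have := mul_le_mul_of_nonneg_right key p
      linarith
    refine ⟨hK, ?_, ?_⟩
    · have h := rec_succ 2 rQ (500 + t)
      push_cast at h
      rw [h]
      have key : 2 * (2025 / ((t : ℚ) + 500) ^ 3 * (((t : ℚ) + 502) / (4 * t + 2002))) +
          975 / (((t + 1 : ℕ) : ℚ) + 500) ^ 3 ≤ 2025 / (((t + 1 : ℕ) : ℚ) + 500) ^ 3 := by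
        push_cast
        generalize (t : ℚ) = x at hx
        rw [div_mul_div_comm, ← mul_div_assoc,
          div_add_div _ _ (by positivity) (by positivity),
          div_le_div_iff₀ (by positivity) (by positivity), ← sub_nonneg]
        ring_nf
        positivity
      have := mul_le_mul_of_nonneg_right key p
      linarith
    · rw [sQp_succ]
      refine i2.trans (le_of_eq ?_)
      rw [← mul_assoc, div_mul_div_comm]
      congr 2 <;> push_cast <;> ring

theorem R1_up (t : ℕ) :
    coeff (500 + t) sR1 ≤ 8500 / ((t : ℚ) + 500) ^ 3 * cc (500 + t) := by
  refine step_up (fun n => coeff n sR1) (fun n => coeff n sQ) 3 (by norm_num)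
    (fun x => 8500 / (x + 500) ^ 3)
    (fun x => 2025 / (x + 501) ^ 3) ?_
    (fun t => by simpa using rec_succ 3 rR1 (500 + t)) (fun t => ?_) ?_ t
  · have := start500
    norm_num only at this ⊢
    tauto
  · have h := (KQ_up (t + 1)).2.1
    rw [show ((t + 1 : ℕ) : ℚ) + 500 = t + 501 by push_cast; ring] at h
    exact h
  · intro x hx
    rw [div_mul_div_comm, ← mul_div_assoc, div_add_div _ _ (by positivity) (by positivity),
      div_le_div_iff₀ (by positivity) (by positivity), ← sub_nonneg]
    ring_nf
    positivity

theorem R2_up (t : ℕ) :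
    coeff (500 + t) sR2 ≤ 11500 / ((t : ℚ) + 500) ^ 3 * cc (500 + t) := by
  refine step_up (fun n => coeff n sR2) (fun n => coeff n sR1) 1 (by norm_num)
    (fun x => 11500 / (x + 500) ^ 3)
    (fun x => 8500 / (x + 501) ^ 3) ?_
    (fun t => by simpa using rec_succ 1 rR2 (500 + t)) (fun t => ?_) ?_ t
  · have := start500
    norm_num only at this ⊢
    tauto
  · have h := R1_up (t + 1)
    rw [show ((t + 1 : ℕ) : ℚ) + 500 = t + 501 by push_cast; ring] at h
    exact h
  · intro x hx
    rw [div_mul_div_comm, ← mul_div_assoc, div_add_div _ _ (by positivity) (by positivity),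
      div_le_div_iff₀ (by positivity) (by positivity), ← sub_nonneg]
    ring_nf
    positivity

theorem R3_up (t : ℕ) :
    coeff (500 + t) sR3 ≤ 23500 / ((t : ℚ) + 500) ^ 3 * cc (500 + t) := by
  refine step_up (fun n => coeff n sR3) (fun n => coeff n sR2) 2 (by norm_num)
    (fun x => 23500 / (x + 500) ^ 3)
    (fun x => 11500 / (x + 501) ^ 3) ?_
    (fun t => by simpa using rec_succ 2 rR3 (500 + t)) (fun t => ?_) ?_ t
  · have := start500
    norm_num only at this ⊢
    tauto
  · have h := R2_up (t + 1)
    rw [show ((t + 1 : ℕ) : ℚ) + 500 = t + 501 by push_cast; ring] at h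
    exact h
  · intro x hx
    rw [div_mul_div_comm, ← mul_div_assoc, div_add_div _ _ (by positivity) (by positivity),
      div_le_div_iff₀ (by positivity) (by positivity), ← sub_nonneg]
    ring_nf
    positivity

theorem R4_up (t : ℕ) :
    coeff (500 + t) sR4 ≤ 4150 / ((t : ℚ) + 500) ^ 3 * cc (500 + t) := by
  refine step_up (fun n => coeff n sR4) (fun n => coeff n sQ) 2 (by norm_num)
    (fun x => 4150 / (x + 500) ^ 3)
    (fun x => 2025 / (x + 501) ^ 3) ?_
    (fun t => by simpa using rec_succ 2 rR4 (500 + t)) (fun t => ?_) ?_ t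
  · have := start500
    norm_num only at this ⊢
    tauto
  · have h := (KQ_up (t + 1)).2.1
    rw [show ((t + 1 : ℕ) : ℚ) + 500 = t + 501 by push_cast; ring] at h
    exact h
  · intro x hx
    rw [div_mul_div_comm, ← mul_div_assoc, div_add_div _ _ (by positivity) (by positivity),
      div_le_div_iff₀ (by positivity) (by positivity), ← sub_nonneg]
    ring_nf
    positivity

end LISProof

namespace LISProof

open Finset PowerSeries

theorem w1_val (t : ℕ) : -2 * coeff (500 + t) Wr =
    4 * ((t : ℚ) + 501) / (4 * t + 1998) * cc (500 + t) := by
  have e : 500 + t = (499 + t) + 1 := by omega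
  have h := cc_succ (499 + t)
  rw [e, Wr_coeff_succ]
  push_cast at h
  rw [div_mul_eq_mul_div, eq_div_iff (by positivity)]
  linear_combination -4 * h

theorem UI_up (t : ℕ) : coeff (500 + t) UI ≤
    (13440 * ((t : ℚ) + 501) / (4 * t + 1998) + (-560 * (6 * t + 3032.9) * (t + 500) +
      189 * (120 * t + 62100) - 112 * (60 * t + 30510) - 7 * (40 * t + 20240)) /
      ((t : ℚ) + 500) ^ 3) * cc (500 + t) := by
  have h := UI_coeff (498 + t)
  rw [show (498 + t) + 2 = 500 + t by omega, w1_val] at h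
  rw [h]
  have h1 := G_lo t
  have h2 := H3_up t
  have h3 := H2_lo t
  have h4 := H1_lo t
  have e : (6 * (t : ℚ) + 3032.9) / ((t : ℚ) + 500) ^ 2 =
      (6 * (t : ℚ) + 3032.9) * (t + 500) / ((t : ℚ) + 500) ^ 3 := by
    rw [div_eq_div_iff (by positivity) (by positivity)]; ring
  rw [e] at h1
  have e2 : (13440 * ((t : ℚ) + 501) / (4 * t + 1998) + (-560 * (6 * t + 3032.9) * (t + 500) +
      189 * (120 * t + 62100) - 112 * (60 * t + 30510) - 7 * (40 * t + 20240)) /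
      ((t : ℚ) + 500) ^ 3) * cc (500 + t) =
      3360 * (4 * ((t : ℚ) + 501) / (4 * t + 1998) * cc (500 + t))
      - 560 * ((6 * (t : ℚ) + 3032.9) * (t + 500) / ((t : ℚ) + 500) ^ 3 * cc (500 + t))
      + 189 * ((120 * t + 62100) / ((t : ℚ) + 500) ^ 3 * cc (500 + t))
      - 112 * ((60 * t + 30510) / ((t : ℚ) + 500) ^ 3 * cc (500 + t))
      - 7 * ((40 * t + 20240) / ((t : ℚ) + 500) ^ 3 * cc (500 + t)) := by ring
  rw [e2]
  linarith

theorem UI_lo (t : ℕ) :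
    (13440 * ((t : ℚ) + 501) / (4 * t + 1998) + (-560 * (6 * t + 3033.6) * (t + 500) +
      189 * (120 * t + 61800) - 112 * (60 * t + 30585) - 7 * (40 * t + 20300) - 269400) /
      ((t : ℚ) + 500) ^ 3) * cc (500 + t) ≤ coeff (500 + t) UI - coeff (500 + t) ErI := by
  have h := UI_coeff (498 + t)
  rw [show (498 + t) + 2 = 500 + t by omega, w1_val] at h
  rw [h, ErI_coeff]
  have h1 := G_up t
  have h2 := H3_lo t
  have h3 := H2_up t
  have h4 := H1_up t
  have h5 := R2_up t
  have h6 := R3_up t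
  have h7 := R4_up t
  have e : (6 * (t : ℚ) + 3033.6) / ((t : ℚ) + 500) ^ 2 =
      (6 * (t : ℚ) + 3033.6) * (t + 500) / ((t : ℚ) + 500) ^ 3 := by
    rw [div_eq_div_iff (by positivity) (by positivity)]; ring
  rw [e] at h1
  have e2 : (13440 * ((t : ℚ) + 501) / (4 * t + 1998) + (-560 * (6 * t + 3033.6) * (t + 500) +
      189 * (120 * t + 61800) - 112 * (60 * t + 30585) - 7 * (40 * t + 20300) - 269400) /
      ((t : ℚ) + 500) ^ 3) * cc (500 + t) =
      3360 * (4 * ((t : ℚ) + 501) / (4 * t + 1998) * cc (500 + t))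
      - 560 * ((6 * (t : ℚ) + 3033.6) * (t + 500) / ((t : ℚ) + 500) ^ 3 * cc (500 + t))
      + 189 * ((120 * t + 61800) / ((t : ℚ) + 500) ^ 3 * cc (500 + t))
      - 112 * ((60 * t + 30585) / ((t : ℚ) + 500) ^ 3 * cc (500 + t))
      - 7 * ((40 * t + 20300) / ((t : ℚ) + 500) ^ 3 * cc (500 + t))
      - (9 * (11500 / ((t : ℚ) + 500) ^ 3 * cc (500 + t)) +
        6 * (23500 / ((t : ℚ) + 500) ^ 3 * cc (500 + t)) +
        6 * (4150 / ((t : ℚ) + 500) ^ 3 * cc (500 + t))) := by ring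
  rw [e2]
  linarith

theorem rat_lt (x : ℚ) (hx : 0 ≤ x) :
    13440 * (x + 1 + 501) / (4 * (x + 1) + 1998) + (-560 * (6 * (x + 1) + 3032.9) * (x + 1 + 500) +
      189 * (120 * (x + 1) + 62100) - 112 * (60 * (x + 1) + 30510) - 7 * (40 * (x + 1) + 20240)) /
      (x + 1 + 500) ^ 3 <
    13440 * (x + 501) / (4 * x + 1998) + (-560 * (6 * x + 3033.6) * (x + 500) +
      189 * (120 * x + 61800) - 112 * (60 * x + 30585) - 7 * (40 * x + 20300) - 269400) /
      (x + 500) ^ 3 := by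
  rw [div_add_div _ _ (by positivity) (by positivity),
    div_add_div _ _ (by positivity) (by positivity),
    div_lt_div_iff₀ (by positivity) (by positivity), ← sub_pos]
  ring_nf
  positivity

theorem UI_big (t : ℕ) : ((500 + t : ℕ) + 2 : ℚ) * coeff (500 + t + 1) UI <
    (4 * (500 + t : ℕ) + 2) * (coeff (500 + t) UI - coeff (500 + t) ErI) := by
  have h1 := UI_up (t + 1)
  have h2 := UI_lo t
  have h3 := rat_lt t (by positivity)
  have hc := cc_succ (500 + t)
  rw [show 500 + (t + 1) = 500 + t + 1 by omega] at h1
  push_cast at h1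
  have p := cc_pos (500 + t)
  have q : (0 : ℚ) < ((500 + t : ℕ) + 2 : ℚ) := by positivity
  have q4 : (0 : ℚ) < (4 * (500 + t : ℕ) + 2 : ℚ) := by positivity
  generalize 13440 * ((t : ℚ) + 1 + 501) / (4 * (t + 1) + 1998) + _ = u at h1 h3
  generalize 13440 * ((t : ℚ) + 501) / (4 * t + 1998) + _ = l at h2 h3
  calc ((500 + t : ℕ) + 2 : ℚ) * coeff (500 + t + 1) UI
      ≤ ((500 + t : ℕ) + 2 : ℚ) * (u * cc (500 + t + 1)) := mul_le_mul_of_nonneg_left h1 q.le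
    _ = (4 * (500 + t : ℕ) + 2) * (u * cc (500 + t)) := by linear_combination u * hc
    _ < (4 * (500 + t : ℕ) + 2) * (l * cc (500 + t)) :=
        mul_lt_mul_of_pos_left (mul_lt_mul_of_pos_right h3 p) q4
    _ ≤ _ := mul_le_mul_of_nonneg_left h2 q4.le

theorem of_UI (n : ℕ) (h : ((n : ℚ) + 1 + 2) * coeff (n + 2) UI <
    (4 * (n + 1) + 2) * (coeff (n + 1) UI - coeff (n + 1) ErI)) :
    ((n : ℚ) + 1 + 2) * numA (n + 2) < (4 * (n + 1) + 2) * numA (n + 1) := by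
  have h1 := mul_le_mul_of_nonneg_left (numA_le (n + 1)) (show (0 : ℚ) ≤ (n : ℚ) + 1 + 2 by positivity)
  have h2 := mul_le_mul_of_nonneg_left (le_numA n) (show (0 : ℚ) ≤ 4 * ((n : ℚ) + 1) + 2 by positivity)
  rw [show n + 1 + 1 = n + 2 by omega] at h1
  linarith

theorem main_ineq (n : ℕ) (hn : 3 ≤ n) :
    ((n : ℚ) + 2) * numA (n + 1) < (4 * n + 2) * numA n := by
  obtain ⟨m, rfl⟩ : ∃ m, n = m + 1 := ⟨n - 1, by omega⟩
  push_cast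
  rcases Nat.lt_or_ge m 182 with h | h
  · have := chkAll_sound 190 180 chk_run m (by omega) (by omega) (by omega)
    rw [show m + 1 + 1 = m + 2 by omega]
    linarith
  rcases Nat.lt_or_ge m 499 with h' | h'
  · apply of_UI
    obtain ⟨k, rfl⟩ : ∃ k, m = k + 1 := ⟨m - 1, by omega⟩
    have := run_all.2 k (by omega) (by omega)
    rw [show k + 1 + 2 = k + 3 by omega, show k + 1 + 1 = k + 2 by omega]
    push_cast
    linarith
  · apply of_UI
    obtain ⟨t, rfl⟩ : ∃ t, m = 499 + t := ⟨m - 499, by omega⟩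
    have := UI_big t
    rw [show 499 + t + 2 = 500 + t + 1 by omega, show 499 + t + 1 = 500 + t by omega]
    push_cast at this ⊢
    linarith

theorem choose_cc (n : ℕ) : (Nat.choose (2 * n) n : ℚ) / (n + 1) = cc n := by
  rw [div_eq_iff (by positivity), ← Nat.centralBinom_eq_two_mul_choose,
    ← succ_mul_catalan_eq_centralBinom]
  unfold cc
  push_cast
  ring

theorem final (n : ℕ) (hn : 3 ≤ n) :
    (numA n : ℚ) / ((Nat.choose (2 * n) n : ℚ) / (n + 1)) >
      (numA (n + 1) : ℚ) / ((Nat.choose (2 * (n + 1)) (n + 1) : ℚ) / (n + 2)) := by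
  have h1 := choose_cc (n + 1)
  push_cast at h1
  rw [show (n : ℚ) + 1 + 1 = n + 2 by ring] at h1
  rw [choose_cc, h1, gt_iff_lt, div_lt_div_iff₀ (cc_pos _) (cc_pos _)]
  have h := mul_lt_mul_of_pos_right (main_ineq n hn) (cc_pos n)
  have hc := cc_succ n
  have q : (0 : ℚ) < (n : ℚ) + 2 := by positivity
  apply lt_of_mul_lt_mul_left _ q.le
  have e : ((n : ℚ) + 2) * (numA n * cc (n + 1)) = (4 * n + 2) * numA n * cc n := by
    linear_combination (numA n : ℚ) * hc
  rw [e]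
  linarith

end LISProof

theorem p_strictly_decreasing :
    ∀ n : ℕ, 3 ≤ n →
      (numA n : ℚ) / ((Nat.choose (2 * n) n : ℚ) / (n + 1)) >
        (numA (n + 1) : ℚ) / ((Nat.choose (2 * (n + 1)) (n + 1) : ℚ) / (n + 2)) := by
  exact LISProof.final
end

section
/- For all integers n ≥ 2 and 1 ≤ k ≤ n+1, with the convention that binom(2n−1, j) = 0 whenever j < 0, one has binom(2n−1, n+1−k) − 3·binom(2n−1, n−k) + 3·binom(2n−1, n−1−k) − binom(2n−1, n−2−k) = 4k(2k²−3n−2)(2n−1)! / ((n+1−k)!(n+1+k)!), as an identity of rational numbers. -/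
/-- The binomial coefficient `binom m j` with an integer lower index, with the
convention that it is `0` when `j < 0`, as a rational number. -/
def binQ (m : ℕ) (j : ℤ) : ℚ :=
  if j < 0 then 0 else (Nat.choose m j.toNat : ℚ)

theorem binQ_aux (m a b : ℕ) (j : ℤ) (hj : j = a) (h : m = a + b) :
    binQ m j = (m.factorial : ℚ) / (a.factorial * b.factorial) := by
  subst hj h
  simp [binQ, Nat.cast_add_choose]

theorem binQ_neg (m : ℕ) (j : ℤ) (hj : j < 0) : binQ m j = 0 := by
  simp [binQ, hj]

theorem binomial_identity :
    ∀ n k : ℕ, 2 ≤ n → 1 ≤ k → k ≤ n + 1 →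
      binQ (2 * n - 1) ((n : ℤ) + 1 - (k : ℤ)) - 3 * binQ (2 * n - 1) ((n : ℤ) - (k : ℤ))
          + 3 * binQ (2 * n - 1) ((n : ℤ) - 1 - (k : ℤ))
          - binQ (2 * n - 1) ((n : ℤ) - 2 - (k : ℤ))
        = 4 * (k : ℚ) * (2 * (k : ℚ) ^ 2 - 3 * (n : ℚ) - 2) * (Nat.factorial (2 * n - 1) : ℚ) /
            ((Nat.factorial (n + 1 - k) : ℚ) * (Nat.factorial (n + 1 + k) : ℚ)) := by
  intro n k hn hk hkn
  obtain ⟨a, ha⟩ : ∃ a, n + 1 = k + a := ⟨n + 1 - k, by omega⟩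
  obtain ⟨b, hb⟩ : ∃ b, n + k = b + 2 := ⟨n + k - 2, by omega⟩
  have h1 : n + 1 - k = a := by omega
  have h2 : n + 1 + k = b + 3 := by omega
  have hbq : (b : ℚ) = n + k - 2 := by
    have : (n : ℚ) + k = b + 2 := by exact_mod_cast hb
    linarith
  have haq : (n : ℚ) + 1 = k + a := by exact_mod_cast ha
  have hF : (b.factorial : ℚ) ≠ 0 := by exact_mod_cast b.factorial_ne_zero
  have e1 : (b : ℚ) + 1 ≠ 0 := by positivity
  have e2 : (b : ℚ) + 1 + 1 ≠ 0 := by positivity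
  have e3 : (b : ℚ) + 2 + 1 ≠ 0 := by positivity
  rw [h1, h2, binQ_aux (2 * n - 1) a b ((n : ℤ) + 1 - (k : ℤ)) (by omega) (by omega)]
  generalize hM : ((2 * n - 1).factorial : ℚ) = M
  rcases a with _ | _ | _ | a
  · rw [binQ_neg _ ((n : ℤ) - (k : ℤ)) (by omega), binQ_neg _ ((n : ℤ) - 1 - (k : ℤ)) (by omega), binQ_neg _ ((n : ℤ) - 2 - (k : ℤ)) (by omega)]
    simp only [Nat.factorial_succ, Nat.factorial_zero]
    push_cast at haq ⊢
    obtain rfl : k = n + 1 := by omega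
    field_simp
    rw [hbq]; push_cast; ring
  · rw [binQ_aux (2 * n - 1) 0 (b + 1) ((n : ℤ) - (k : ℤ)) (by omega) (by omega),
      binQ_neg _ ((n : ℤ) - 1 - (k : ℤ)) (by omega), binQ_neg _ ((n : ℤ) - 2 - (k : ℤ)) (by omega), hM]
    simp only [Nat.factorial_succ, Nat.factorial_zero]
    push_cast at haq ⊢
    obtain rfl : k = n := by omega
    field_simp
    rw [hbq]; ring
  · rw [binQ_aux (2 * n - 1) 1 (b + 1) ((n : ℤ) - (k : ℤ)) (by omega) (by omega),
      binQ_aux (2 * n - 1) 0 (b + 2) ((n : ℤ) - 1 - (k : ℤ)) (by omega) (by omega), binQ_neg _ ((n : ℤ) - 2 - (k : ℤ)) (by omega), hM]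
    simp only [Nat.factorial_succ, Nat.factorial_zero]
    push_cast at haq ⊢
    obtain rfl : n = k + 1 := by omega
    field_simp
    rw [hbq]; push_cast; ring
  · rw [binQ_aux (2 * n - 1) (a + 2) (b + 1) ((n : ℤ) - (k : ℤ)) (by omega) (by omega),
      binQ_aux (2 * n - 1) (a + 1) (b + 2) ((n : ℤ) - 1 - (k : ℤ)) (by omega) (by omega),
      binQ_aux (2 * n - 1) a (b + 3) ((n : ℤ) - 2 - (k : ℤ)) (by omega) (by omega), hM]
    have hA : (a.factorial : ℚ) ≠ 0 := by exact_mod_cast a.factorial_ne_zero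
    have f1 : (a : ℚ) + 1 ≠ 0 := by positivity
    have f2 : (a : ℚ) + 1 + 1 ≠ 0 := by positivity
    have f3 : (a : ℚ) + 2 + 1 ≠ 0 := by positivity
    simp only [Nat.factorial_succ]
    push_cast at haq ⊢
    have hn' : (n : ℚ) = k + a + 2 := by linarith
    field_simp
    rw [hbq, hn']; ring
end

section
/- For all integers n and k with 1 ≤ k < n, binom(2n, n−k) / binom(2n, n) ≤ (n/(n−k)) · exp(−k²/n). -/
lemma aux_ratio (t : ℝ) (h0 : 0 ≤ t) (h1 : t < 1) :
    1 - t ≤ Real.exp (-(2 * t)) * (1 + t) := by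
  have hs := Real.hasSum_log_sub_log_of_abs_lt_one (x := t) (by rw [abs_of_nonneg h0]; exact h1)
  have h := sum_le_hasSum {0} (fun i _ => by positivity) hs
  simp at h
  have h2 : Real.log (1 - t) ≤ -(2 * t) + Real.log (1 + t) := by linarith
  have h3 := Real.exp_le_exp.mpr h2
  rwa [Real.exp_add, Real.exp_log (by linarith), Real.exp_log (by linarith)] at h3

lemma aux_main (n k : ℕ) (h : k < n) :
    (Nat.choose (2 * n) (n - k) : ℝ) * ((n : ℝ) - k)
      ≤ (Nat.choose (2 * n) n : ℝ) * n * Real.exp (-(k : ℝ) ^ 2 / (n : ℝ)) := by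
  induction k with
  | zero => simp
  | succ k ih =>
    have ih := ih (by omega)
    obtain ⟨m, rfl⟩ : ∃ m, n = m + k + 1 := ⟨n - k - 1, by omega⟩
    have hm : 0 < m := by omega
    have e := Nat.choose_succ_right_eq (2 * (m + k + 1)) m
    rw [show m + k + 1 - k = m + 1 by omega] at ih
    rw [show m + k + 1 - (k + 1) = m by omega]
    rw [show 2 * (m + k + 1) - m = m + 2 * k + 2 by omega] at e
    have e' : (Nat.choose (2 * (m + k + 1)) (m + 1) : ℝ) * (m + 1)
        = Nat.choose (2 * (m + k + 1)) m * (m + 2 * k + 2) := by exact_mod_cast e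
    generalize (Nat.choose (2 * (m + k + 1)) (m + 1) : ℝ) = A at *
    generalize (Nat.choose (2 * (m + k + 1)) m : ℝ) = B at *
    have hC : (0 : ℝ) ≤ Nat.choose (2 * (m + k + 1)) (m + k + 1) := by positivity
    generalize (Nat.choose (2 * (m + k + 1)) (m + k + 1) : ℝ) = C at *
    have hm' : (0 : ℝ) < m := by exact_mod_cast hm
    have hk : (0 : ℝ) ≤ k := by positivity
    push_cast at *
    generalize (m : ℝ) = x at *
    generalize (k : ℝ) = y at *
    have hn : 0 < x + y + 1 := by linarith
    have r := aux_ratio ((y + 1) / (x + y + 1)) (by positivity)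
      (by rw [div_lt_one hn]; linarith)
    have r2 : x ≤ Real.exp (-(2 * ((y + 1) / (x + y + 1)))) * (x + 2 * y + 2) := by
      have := mul_le_mul_of_nonneg_right r hn.le
      have e1 : (1 - (y + 1) / (x + y + 1)) * (x + y + 1) = x := by field_simp; ring
      have e2 : (1 + (y + 1) / (x + y + 1)) * (x + y + 1) = x + 2 * y + 2 := by
        field_simp; ring
      rwa [mul_assoc, e1, e2] at this
    have r3 : Real.exp (-y ^ 2 / (x + y + 1)) * Real.exp (-(2 * ((y + 1) / (x + y + 1))))
        ≤ Real.exp (-(y + 1) ^ 2 / (x + y + 1)) := by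
      rw [← Real.exp_add, Real.exp_le_exp]
      rw [show -y ^ 2 / (x + y + 1) + -(2 * ((y + 1) / (x + y + 1)))
        = (-y ^ 2 - 2 * (y + 1)) / (x + y + 1) by ring]
      gcongr
      linarith
    have hp : 0 < x + 2 * y + 2 := by linarith
    refine le_of_mul_le_mul_right ?_ hp
    calc B * (x + y + 1 - (y + 1)) * (x + 2 * y + 2)
        = A * (x + y + 1 - y) * x := by linear_combination (-x) * e'
      _ ≤ (C * (x + y + 1) * Real.exp (-y ^ 2 / (x + y + 1))) *
          (Real.exp (-(2 * ((y + 1) / (x + y + 1)))) * (x + 2 * y + 2)) := by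
        apply mul_le_mul ih r2 hm'.le (by positivity)
      _ = C * (x + y + 1) * (x + 2 * y + 2) * (Real.exp (-y ^ 2 / (x + y + 1)) *
          Real.exp (-(2 * ((y + 1) / (x + y + 1))))) := by ring
      _ ≤ C * (x + y + 1) * (x + 2 * y + 2) * Real.exp (-(y + 1) ^ 2 / (x + y + 1)) := by
        gcongr
      _ = _ := by ring

theorem binom_ratio_upper_bound :
    ∀ n k : ℕ, 1 ≤ k → k < n →
      (Nat.choose (2 * n) (n - k) : ℝ) / (Nat.choose (2 * n) n : ℝ)
        ≤ ((n : ℝ) / ((n : ℝ) - (k : ℝ))) * Real.exp (-(k : ℝ) ^ 2 / (n : ℝ)) := by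
  intro n k _ h
  have hm := aux_main n k h
  have hC : (0 : ℝ) < Nat.choose (2 * n) n := by
    exact_mod_cast Nat.choose_pos (by omega)
  have hd : (0 : ℝ) < (n : ℝ) - k := by
    have : (k : ℝ) < n := by exact_mod_cast h
    linarith
  rw [div_mul_eq_mul_div, div_le_div_iff₀ hC hd]
  linarith
end
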